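/- arXiv:2112.11970 — 3 statements merged into one kernel-verified Lean document; each statement's English description precedes it below -/
import Mathlib

section
/- No m-necklace with m ≥ 4 is a Burling graph. -/
namespace BurlingFormal

open SimpleGraph

/-- An orientation of a simple graph, given as a relation choosing a direction for each edge. -/
def IsOrientation {V : Type} (G : SimpleGraph V) (A : V → V → Prop) : Prop :=
  (∀ u v, A u v → G.Adj u v) ∧ (∀ u v, G.Adj u v → (A u v ↔ ¬ A v u))

/-- A chordless cycle: a cycle such that every adjacency between its vertices is a cycle edge. -/
def IsChordlessCycle {V : Type} (G : SimpleGraph V) {v : V} (c : G.Walk v v) : Prop :=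
  c.IsCycle ∧ ∀ x y, x ∈ c.support → y ∈ c.support → G.Adj x y → s(x, y) ∈ c.edges

/-- A hole: a chordless cycle of length at least 4. -/
def IsHole {V : Type} (G : SimpleGraph V) {v : V} (c : G.Walk v v) : Prop :=
  IsChordlessCycle G c ∧ 4 ≤ c.length

/-- A source of a hole w.r.t. an orientation: both its neighbours on the hole are out-neighbours. -/
def IsHoleSource {V : Type} {G : SimpleGraph V} {v : V} (A : V → V → Prop)
    (c : G.Walk v v) (x : V) : Prop :=
  x ∈ c.support ∧ ∀ y, s(x, y) ∈ c.edges → A x y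

/-- A sink of a hole w.r.t. an orientation: both its neighbours on the hole are in-neighbours. -/
def IsHoleSink {V : Type} {G : SimpleGraph V} {v : V} (A : V → V → Prop)
    (c : G.Walk v v) (x : V) : Prop :=
  x ∈ c.support ∧ ∀ y, s(x, y) ∈ c.edges → A y x

/-- An extremum of a hole: a source or a sink of it. -/
def IsHoleExtremum {V : Type} {G : SimpleGraph V} {v : V} (A : V → V → Prop)
    (c : G.Walk v v) (x : V) : Prop :=
  IsHoleSource A c x ∨ IsHoleSink A c x

/-- The hole has exactly two sources and exactly two sinks. -/
def TwoSourcesTwoSinks {V : Type} {G : SimpleGraph V} {v : V} (A : V → V → Prop)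
    (c : G.Walk v v) : Prop :=
  (∃ s₁ s₂, s₁ ≠ s₂ ∧ IsHoleSource A c s₁ ∧ IsHoleSource A c s₂ ∧
    ∀ s, IsHoleSource A c s → s = s₁ ∨ s = s₂) ∧
  (∃ t₁ t₂, t₁ ≠ t₂ ∧ IsHoleSink A c t₁ ∧ IsHoleSink A c t₂ ∧
    ∀ t, IsHoleSink A c t → t = t₁ ∨ t = t₂)

/-- The pivot of a hole: a sink adjacent on the hole to all of its sources. -/
def IsHolePivot {V : Type} {G : SimpleGraph V} {v : V} (A : V → V → Prop)
    (c : G.Walk v v) (x : V) : Prop :=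
  IsHoleSink A c x ∧ ∀ y, IsHoleSource A c y → s(x, y) ∈ c.edges

/-- A subordinate vertex of a hole: neither an antenna (source) nor the pivot. -/
def IsHoleSubordinate {V : Type} {G : SimpleGraph V} {v : V} (A : V → V → Prop)
    (c : G.Walk v v) (x : V) : Prop :=
  x ∈ c.support ∧ ¬ IsHoleSource A c x ∧ ¬ IsHolePivot A c x

/-- `S` is the vertex set of a (possibly empty) branch (downward path) starting at `u`
in the rooted tree given by the parent function. -/
def IsBranchFrom {V : Type} (parent : V → V) (u : V) (S : Set V) : Prop :=
  S = ∅ ∨ (u ∈ S ∧ (∀ w ∈ S, w ≠ u → parent w ∈ S ∧ parent w ≠ w) ∧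
    ∀ w ∈ S, ∀ w' ∈ S, w ≠ u → w' ≠ u → parent w = parent w' → w = w')

/-- A Burling tree: a rooted tree (given by a parent function) together with a last-born
function and a choose function assigning to each non-last-born non-root vertex the vertex set
of a branch starting at the last-born of its parent. -/
structure BurlingTree (V : Type) where
  parent : V → V
  root : V
  parent_root : parent root = root
  reach : ∀ v, ∃ n, parent^[n] v = root
  lastBorn : V → V
  lastBorn_child : ∀ v, (∃ u, u ≠ v ∧ parent u = v) → parent (lastBorn v) = v ∧ lastBorn v ≠ v
  choosePath : V → Set V
  choosePath_empty : ∀ v, v = root ∨ v = lastBorn (parent v) → choosePath v = ∅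
  choosePath_branch : ∀ v, v ≠ root → v ≠ lastBorn (parent v) →
    IsBranchFrom parent (lastBorn (parent v)) (choosePath v)

/-- The arcs of the oriented graph fully derived from a Burling tree. -/
def BurlingTree.Arc {V : Type} (T : BurlingTree V) (u v : V) : Prop :=
  v ∈ T.choosePath u

/-- `A` orients `G` so that `G` with this orientation is an oriented graph derived from
some Burling tree (an oriented Burling graph). -/
def IsOrientedBurling {W : Type} (G : SimpleGraph W) (A : W → W → Prop) : Prop :=
  IsOrientation G A ∧
    ∃ (V : Type) (T : BurlingTree V) (f : W ↪ V), ∀ u v, A u v ↔ T.Arc (f u) (f v)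

/-- A Burling graph (equivalently, a derived graph): the underlying graph of an oriented
graph derived from a Burling tree. -/
def IsBurlingGraph {W : Type} (G : SimpleGraph W) : Prop :=
  ∃ A, IsOrientedBurling G A

/-- A global subordinate vertex of a Burling graph: subordinate in some hole, for every
orientation of the graph as an oriented Burling graph. -/
def IsGlobalSubordinate {W : Type} (G : SimpleGraph W) (x : W) : Prop :=
  ∀ A, IsOrientedBurling G A →
    ∃ (v : W) (c : G.Walk v v), IsHole G c ∧ IsHoleSubordinate A c x

/-- `H` is a subdivision of `G` via the branch-vertex embedding `f` and the system of
paths `P` replacing the edges of `G`. -/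
def IsSubdivisionVia {V W : Type} (H : SimpleGraph W) (G : SimpleGraph V) (f : V ↪ W)
    (P : ∀ ⦃u v : V⦄, G.Adj u v → H.Walk (f u) (f v)) : Prop :=
  (∀ ⦃u v⦄ (h : G.Adj u v), (P h).IsPath ∧ 1 ≤ (P h).length) ∧
  (∀ ⦃u v⦄ (h : G.Adj u v) (x : V), f x ∈ (P h).support → x = u ∨ x = v) ∧
  (∀ ⦃u v u' v'⦄ (h : G.Adj u v) (h' : G.Adj u' v'), s(u, v) ≠ s(u', v') →
    ∀ w, w ∈ (P h).support → w ∈ (P h').support → ∃ x : V, w = f x) ∧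
  (∀ w : W, ∃ u v, ∃ h : G.Adj u v, w ∈ (P h).support) ∧
  (∀ ⦃x y : W⦄, H.Adj x y → ∃ u v, ∃ h : G.Adj u v, s(x, y) ∈ (P h).edges)

/-- `H` is a subdivision of `G`. -/
def IsSubdivision {V W : Type} (H : SimpleGraph W) (G : SimpleGraph V) : Prop :=
  ∃ (f : V ↪ W) (P : ∀ ⦃u v : V⦄, G.Adj u v → H.Walk (f u) (f v)), IsSubdivisionVia H G f P

/-- `G` contains an induced copy of `H`. -/
def InducedCopy {V W : Type} (H : SimpleGraph W) (G : SimpleGraph V) : Prop :=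
  ∃ f : W ↪ V, ∀ a b, H.Adj a b ↔ G.Adj (f a) (f b)

/-- The clique number of a graph. -/
noncomputable def cliqueNumber {V : Type} (G : SimpleGraph V) : ℕ :=
  sSup {n | ∃ s : Finset V, G.IsNClique n s}

/-- `G` belongs to `Forb*(H)`: it has no induced subdivision of `H`. -/
def InForbs {VH V : Type} (H : SimpleGraph VH) (G : SimpleGraph V) : Prop :=
  ∀ (U : Type) (S : SimpleGraph U), IsSubdivision S H → ¬ InducedCopy S G

/-- `H` is weakly pervasive: the class `Forb*(H)` (of finite graphs) is χ-bounded. -/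
def WeaklyPervasive {VH : Type} (H : SimpleGraph VH) : Prop :=
  ∃ f : ℕ → ℕ, ∀ (V : Type) (_ : Fintype V) (G : SimpleGraph V),
    InForbs H G → G.chromaticNumber ≤ (f (cliqueNumber G) : ℕ∞)

/-- `G` has a star cutset centered at `v`. -/
def HasStarCutsetAt {V : Type} (G : SimpleGraph V) (v : V) : Prop :=
  ∃ S : Set V, v ∈ S ∧ (∀ u ∈ S, u = v ∨ G.Adj v u) ∧ ¬ (G.induce Sᶜ).Preconnected

/-- `G` has a star cutset. -/
def HasStarCutset {V : Type} (G : SimpleGraph V) : Prop :=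
  ∃ v, HasStarCutsetAt G v

/-- The structure of an `m`-necklace on the graph `G`: beads `B i` (chordless cycles of
length at least 4 through the non-adjacent vertices `a i`, `b i`) joined cyclically by
paths `P i` from `b i` to `a (i+1)` (of length possibly 0, i.e. identification),
with no further vertices or edges. -/
structure Necklace {V : Type} (G : SimpleGraph V) (m : ℕ) where
  a : ZMod m → V
  b : ZMod m → V
  B : ∀ i, G.Walk (a i) (a i)
  P : ∀ i, G.Walk (b i) (a (i + 1))
  B_cycle : ∀ i, (B i).IsCycle
  B_len : ∀ i, 4 ≤ (B i).length
  b_mem : ∀ i, b i ∈ (B i).support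
  ab_ne : ∀ i, a i ≠ b i
  ab_nonadj : ∀ i, ¬ G.Adj (a i) (b i)
  P_path : ∀ i, (P i).IsPath
  bead_disjoint : ∀ i j, i ≠ j → ∀ x, x ∈ (B i).support → x ∈ (B j).support →
    (j = i + 1 ∧ x = b i ∧ x = a j) ∨ (i = j + 1 ∧ x = b j ∧ x = a i)
  path_bead_disjoint : ∀ i j (x : V), x ∈ (P i).support → x ∈ (B j).support →
    x = b i ∨ x = a (i + 1)
  path_disjoint : ∀ i j, i ≠ j → ∀ x, x ∈ (P i).support → x ∈ (P j).support →
    (x = b i ∨ x = a (i + 1)) ∧ (x = b j ∨ x = a (j + 1))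
  cover_vertex : ∀ x : V, (∃ i, x ∈ (B i).support) ∨ ∃ i, x ∈ (P i).support
  cover_edge : ∀ x y, G.Adj x y → (∃ i, s(x, y) ∈ (B i).edges) ∨ ∃ i, s(x, y) ∈ (P i).edges

/-- The bead `B i` of a necklace is short if `a i` and `b i` have a common neighbour. -/
def Necklace.Short {V : Type} {G : SimpleGraph V} {m : ℕ} (N : Necklace G m)
    (i : ZMod m) : Prop :=
  ∃ w, G.Adj (N.a i) w ∧ G.Adj (N.b i) w

/-- A chandelier: an in-tree (given by a parent function on `V \ {hub}`) with at least two
leaves, together with an extra vertex `hub` joined to all the leaves. -/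
structure Chandelier (V : Type) where
  hub : V
  root : V
  parent : V → V
  hub_ne_root : hub ≠ root
  parent_root : parent root = root
  parent_hub : parent hub = hub
  parent_ne_hub : ∀ u, u ≠ hub → parent u ≠ hub
  reach : ∀ u, u ≠ hub → ∃ n, parent^[n] u = root
  two_leaves : ∃ l₁ l₂ : V, l₁ ≠ l₂ ∧
    (l₁ ≠ hub ∧ l₁ ≠ root ∧ ∀ w, parent w = l₁ → w = l₁) ∧
    (l₂ ≠ hub ∧ l₂ ≠ root ∧ ∀ w, parent w = l₂ → w = l₂)

/-- A leaf of the in-tree of a chandelier. -/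
def Chandelier.IsLeaf {V : Type} (C : Chandelier V) (u : V) : Prop :=
  u ≠ C.hub ∧ u ≠ C.root ∧ ∀ w, C.parent w = u → w = u

/-- The arcs of (the oriented version of) a chandelier. -/
def Chandelier.Arc {V : Type} (C : Chandelier V) (u w : V) : Prop :=
  (u ≠ C.hub ∧ u ≠ C.root ∧ w = C.parent u) ∨ (C.IsLeaf u ∧ w = C.hub)

/-- The underlying (non-oriented) graph of a chandelier. -/
def Chandelier.graph {V : Type} (C : Chandelier V) : SimpleGraph V :=
  SimpleGraph.fromRel C.Arc

/-- There is a vertex lying on every cycle of the graph. -/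
def HasUniversalCycleVertex {V : Type} (G : SimpleGraph V) : Prop :=
  ∃ x : V, ∀ (w : V) (c : G.Walk w w), c.IsCycle → x ∈ c.support

/-- A Burling-admissible type-4 subdivision of `K₄` sitting inside `G`: branch vertices
`x, y, z, w`, where the two non-subdivided edges `xy`, `xz` share the endpoint `x`, and the
four other edges are replaced by internally disjoint paths of length at least 2. -/
structure Type4K4Core {V : Type} (G : SimpleGraph V) where
  x : V
  y : V
  z : V
  w : V
  ne_xy : x ≠ y
  ne_xz : x ≠ z
  ne_xw : x ≠ w
  ne_yz : y ≠ z
  ne_yw : y ≠ w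
  ne_zw : z ≠ w
  adj_xy : G.Adj x y
  adj_xz : G.Adj x z
  Pxw : G.Walk x w
  Pyz : G.Walk y z
  Pyw : G.Walk y w
  Pzw : G.Walk z w
  Pxw_path : Pxw.IsPath
  Pyz_path : Pyz.IsPath
  Pyw_path : Pyw.IsPath
  Pzw_path : Pzw.IsPath
  Pxw_len : 2 ≤ Pxw.length
  Pyz_len : 2 ≤ Pyz.length
  Pyw_len : 2 ≤ Pyw.length
  Pzw_len : 2 ≤ Pzw.length
  d₁ : ∀ v, v ∈ Pxw.support → v ∈ Pyz.support → False
  d₂ : ∀ v, v ∈ Pxw.support → v ∈ Pyw.support → v = w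
  d₃ : ∀ v, v ∈ Pxw.support → v ∈ Pzw.support → v = w
  d₄ : ∀ v, v ∈ Pyz.support → v ∈ Pyw.support → v = y
  d₅ : ∀ v, v ∈ Pyz.support → v ∈ Pzw.support → v = z
  d₆ : ∀ v, v ∈ Pyw.support → v ∈ Pzw.support → v = w

/-- The vertex set of a type-4 `K₄`-subdivision configuration. -/
def Type4K4Core.supp {V : Type} {G : SimpleGraph V} (c : Type4K4Core G) : Set V :=
  {v | v ∈ c.Pxw.support ∨ v ∈ c.Pyz.support ∨ v ∈ c.Pyw.support ∨ v ∈ c.Pzw.support}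

/-- The edge set of a type-4 `K₄`-subdivision configuration. -/
def Type4K4Core.edges {V : Type} {G : SimpleGraph V} (c : Type4K4Core G) : Set (Sym2 V) :=
  {e | e ∈ c.Pxw.edges ∨ e ∈ c.Pyz.edges ∨ e ∈ c.Pyw.edges ∨ e ∈ c.Pzw.edges ∨
    e = s(c.x, c.y) ∨ e = s(c.x, c.z)}

/-- The configuration exhausts the whole graph `G`. -/
def Type4K4Core.Spanning {V : Type} {G : SimpleGraph V} (c : Type4K4Core G) : Prop :=
  (∀ v : V, v ∈ c.supp) ∧ ∀ u v, G.Adj u v → s(u, v) ∈ c.edges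

/-- A vertex of degree exactly 2. -/
def DegTwo {V : Type} (G : SimpleGraph V) (x : V) : Prop :=
  ∃ p q, p ≠ q ∧ G.Adj x p ∧ G.Adj x q ∧ ∀ r, G.Adj x r → r = p ∨ r = q


section Tree
variable {V : Type} (T : BurlingTree V)

def Anc (w v : V) : Prop := ∃ n, T.parent^[n] v = w

open Classical in
noncomputable def dep (v : V) : ℕ := Nat.find (T.reach v)

theorem dep_parent {v : V} (h : v ≠ T.root) : dep T v = dep T (T.parent v) + 1 := by
  classical
  unfold dep
  rw [Nat.find_comp_succ (T.reach v) (T.reach (T.parent v))]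
  · simp
  · exact h

theorem dep_root : dep T T.root = 0 := by
  classical
  unfold dep
  simp

theorem parent_ne {v : V} (h : v ≠ T.root) : T.parent v ≠ v := by
  intro e
  have := dep_parent T h
  rw [e] at this
  omega

theorem Anc.refl (v : V) : Anc T v v := ⟨0, rfl⟩

theorem Anc.par (v : V) : Anc T (T.parent v) v := ⟨1, rfl⟩

theorem Anc.trans {a b c : V} (h : Anc T a b) (h' : Anc T b c) : Anc T a c := by
  obtain ⟨n, rfl⟩ := h
  obtain ⟨m, rfl⟩ := h'
  exact ⟨n + m, by rw [Function.iterate_add_apply]⟩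

theorem Anc.cases {a v : V} (h : Anc T a v) : a = v ∨ (Anc T a (T.parent v)) := by
  obtain ⟨n, hn⟩ := h
  cases n with
  | zero => exact Or.inl hn.symm
  | succ k => exact Or.inr ⟨k, by simpa using hn⟩

theorem Anc.dep_le {a v : V} (h : Anc T a v) : dep T a ≤ dep T v := by
  obtain ⟨n, hn⟩ := h
  induction n generalizing v with
  | zero => simp at hn; subst hn; exact le_rfl
  | succ k ih =>
    have := ih (v := T.parent v) (by simpa using hn)
    by_cases hv : v = T.root
    · subst hv; rwa [T.parent_root] at this
    · have := dep_parent T hv; omega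

theorem Anc.eq_of_dep {a v : V} (h : Anc T a v) (hd : dep T v ≤ dep T a) : a = v := by
  obtain ⟨n, hn⟩ := h
  by_cases hv : v = T.root
  · subst hv
    rw [← hn]
    exact Function.iterate_fixed T.parent_root n
  · rcases Anc.cases T ⟨n, hn⟩ with h | h
    · exact h
    · have := h.dep_le
      have := dep_parent T hv
      omega

theorem Anc.total {a b v : V} (h : Anc T a v) (h' : Anc T b v) : Anc T a b ∨ Anc T b a := by
  obtain ⟨n, rfl⟩ := h
  obtain ⟨m, rfl⟩ := h'
  rcases le_total n m with hl | hl
  · right; exact ⟨m - n, by rw [← Function.iterate_add_apply]; congr 1; omega⟩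
  · left; exact ⟨n - m, by rw [← Function.iterate_add_apply]; congr 1; omega⟩

theorem Anc.exists_dep {v : V} (k : ℕ) (hk : k ≤ dep T v) : ∃ w, Anc T w v ∧ dep T w = k := by
  induction hd : dep T v generalizing v with
  | zero => exact ⟨v, Anc.refl T v, by omega⟩
  | succ n ih =>
    by_cases hv : k = dep T v
    · exact ⟨v, Anc.refl T v, hv.symm⟩
    · have hr : v ≠ T.root := by
        rintro rfl
        rw [dep_root] at hd; omega
      have := dep_parent T hr
      obtain ⟨w, hw, hw'⟩ := ih (v := T.parent v) (by omega) (by omega)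
      exact ⟨w, hw.trans T (Anc.par T v), hw'⟩

theorem arc_basic {u v : V} (h : T.Arc u v) : u ≠ T.root ∧ u ≠ T.lastBorn (T.parent u) ∧
    T.parent (T.lastBorn (T.parent u)) = T.parent u ∧
    dep T (T.lastBorn (T.parent u)) = dep T u ∧
    T.lastBorn (T.parent u) ∈ T.choosePath u ∧
    (∀ w ∈ T.choosePath u, w ≠ T.lastBorn (T.parent u) →
      T.parent w ∈ T.choosePath u ∧ T.parent w ≠ w) ∧
    (∀ w ∈ T.choosePath u, ∀ w' ∈ T.choosePath u, w ≠ T.lastBorn (T.parent u) →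
      w' ≠ T.lastBorn (T.parent u) → T.parent w = T.parent w' → w = w') := by
  unfold BurlingTree.Arc at h
  have hr : u ≠ T.root := by
    intro e; rw [T.choosePath_empty u (Or.inl e)] at h; exact h
  have hl : u ≠ T.lastBorn (T.parent u) := by
    intro e; rw [T.choosePath_empty u (Or.inr e)] at h; exact h
  obtain ⟨h1, h2⟩ := T.lastBorn_child (T.parent u) ⟨u, (parent_ne T hr).symm, rfl⟩
  refine ⟨hr, hl, h1, ?_, ?_⟩
  · have hlr : T.lastBorn (T.parent u) ≠ T.root := by
      intro e
      rw [e, T.parent_root] at h1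
      exact h2 (e.trans h1)
    rw [dep_parent T hlr, dep_parent T hr, h1]
  · rcases T.choosePath_branch u hr hl with h' | h'
    · rw [h'] at h; exact h.elim
    · exact h'

theorem arc_anc {u v : V} (h : T.Arc u v) : Anc T (T.lastBorn (T.parent u)) v := by
  obtain ⟨hr, hl, h1, h2, h3, h4, h5⟩ := arc_basic T h
  unfold BurlingTree.Arc at h
  obtain ⟨n, hn⟩ := T.reach v
  induction n generalizing v with
  | zero =>
    simp at hn
    by_cases e : v = T.lastBorn (T.parent u)
    · rw [← e]; exact Anc.refl T v
    · have := (h4 v h e).2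
      rw [hn] at this
      exact (this T.parent_root).elim
  | succ k ih =>
    by_cases e : v = T.lastBorn (T.parent u)
    · rw [← e]; exact Anc.refl T v
    · exact (ih (h4 v h e).1 (by simpa using hn)).trans T (Anc.par T v)

theorem arc_closed {u v w : V} (h : T.Arc u v) (hw : Anc T (T.lastBorn (T.parent u)) w)
    (hwv : Anc T w v) : T.Arc u w := by
  obtain ⟨n, hn⟩ := hwv
  induction n generalizing v with
  | zero => simp at hn; rwa [← hn]
  | succ k ih =>
    obtain ⟨hr, hl, h1, h2, h3, h4, h5⟩ := arc_basic T h
    by_cases e : v = T.lastBorn (T.parent u)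
    · have : w = v := Anc.eq_of_dep T ⟨k + 1, hn⟩ (by rw [e]; exact hw.dep_le)
      rwa [this]
    · exact ih (h4 v h e).1 (by simpa using hn)

theorem arc_dep_inj {u v w : V} (h : T.Arc u v) (h' : T.Arc u w) (hd : dep T v = dep T w) :
    v = w := by
  obtain ⟨hr, hl, h1, h2, h3, h4, h5⟩ := arc_basic T h
  have key : ∀ d v w, T.Arc u v → T.Arc u w → dep T v = d → dep T w = d → v = w := by
    intro d
    induction d with
    | zero =>
      intro v w hv hw e1 e2
      rw [← Anc.eq_of_dep T (arc_anc T hv) (by omega), ← Anc.eq_of_dep T (arc_anc T hw) (by omega)]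
    | succ d ih =>
      intro v w hv hw e1 e2
      by_cases a1 : v = T.lastBorn (T.parent u)
      · rw [a1]; exact Anc.eq_of_dep T (arc_anc T hw) (by rw [← a1]; omega)
      by_cases a2 : w = T.lastBorn (T.parent u)
      · rw [a2]; exact (Anc.eq_of_dep T (arc_anc T hv) (by rw [← a2]; omega)).symm
      refine h5 v hv w hw a1 a2 (ih _ _ (h4 v hv a1).1 (h4 w hw a2).1 ?_ ?_)
      · have := dep_parent T (v := v) (by rintro rfl; exact (h4 _ hv a1).2 T.parent_root)
        omega
      · have := dep_parent T (v := w) (by rintro rfl; exact (h4 _ hw a2).2 T.parent_root)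
        omega
  exact key _ v w h h' rfl hd.symm

theorem arc_comp {u v w : V} (h : T.Arc u v) (h' : T.Arc u w) : Anc T v w ∨ Anc T w v := by
  have key : ∀ v w, T.Arc u v → T.Arc u w → dep T v ≤ dep T w → Anc T v w := by
    intro v w h h' hd
    obtain ⟨x, hx, hxd⟩ := Anc.exists_dep T (v := w) (dep T v) hd
    have hlx : Anc T (T.lastBorn (T.parent u)) x := by
      rcases Anc.total T (arc_anc T h') hx with h1 | h1
      · exact h1
      · have := Anc.eq_of_dep T h1 (by rw [hxd]; exact (arc_anc T h).dep_le)
        rw [this]; exact Anc.refl T _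
    rw [arc_dep_inj T h (arc_closed T h' hlx hx) hxd.symm]
    exact hx
  rcases le_total (dep T v) (dep T w) with hl | hl
  · exact Or.inl (key v w h h' hl)
  · exact Or.inr (key w v h' h hl)

theorem arc_in {u v w : V} (h : T.Arc u v) (hv : Anc T w v) (hu : ¬ Anc T w u) : T.Arc u w := by
  obtain ⟨hr, hl, h1, h2, h3, -⟩ := arc_basic T h
  rcases Anc.total T (arc_anc T h) hv with h' | h'
  · exact arc_closed T h h' hv
  · rcases h'.cases with e | e
    · rw [e]; exact h3
    · rw [h1] at e
      exact (hu (e.trans T (Anc.par T u))).elim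

theorem arc_out {u v w : V} (h : T.Arc u v) (hu : Anc T w u) (hv : ¬ Anc T w v) : u = w := by
  obtain ⟨hr, hl, h1, h2, h3, -⟩ := arc_basic T h
  rcases hu.cases with e | e
  · exact e.symm
  · rw [← h1] at e
    exact (hv ((e.trans T (Anc.par T _)).trans T (arc_anc T h))).elim

theorem not_arc_down {y z : V} (h : Anc T y z) : ¬ T.Arc y z := by
  intro ha
  obtain ⟨hr, hl, h1, h2, h3, -⟩ := arc_basic T ha
  rcases Anc.total T (arc_anc T ha) h with h' | h'
  · exact hl (Anc.eq_of_dep T h' (by omega)).symm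
  · exact hl (Anc.eq_of_dep T h' (by omega))

theorem not_arc_up {y z : V} (h : Anc T y z) : ¬ T.Arc z y := by
  intro ha
  obtain ⟨hr, hl, h1, h2, h3, -⟩ := arc_basic T ha
  have h' := (arc_anc T ha).trans T h
  exact hl (Anc.eq_of_dep T h' (by omega)).symm

theorem arc_dep {u v : V} (h : T.Arc u v) : dep T u ≤ dep T v := by
  obtain ⟨hr, hl, h1, h2, h3, -⟩ := arc_basic T h
  have := (arc_anc T h).dep_le
  omega

theorem arc_dep2 {u v x : V} (h : T.Arc u v) (h' : T.Arc v x) : dep T u < dep T v := by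
  obtain ⟨hr, hl, h1, h2, h3, -⟩ := arc_basic T h
  have := (arc_anc T h).dep_le
  by_contra hc
  have e := Anc.eq_of_dep T (arc_anc T h) (by omega)
  obtain ⟨-, hl', -⟩ := arc_basic T h'
  rw [← e, h1] at hl'
  exact hl' rfl

end Tree
section AbsHole
variable {W : Type}

/-- A set-based description of holes: 2-regular and without cut vertices. -/
structure AbsHole (G : SimpleGraph W) (S : Finset W) : Prop where
  ne : S.Nonempty
  nb : ∀ v ∈ S, ∃ p q, p ≠ q ∧ p ∈ S ∧ q ∈ S ∧ G.Adj v p ∧ G.Adj v q ∧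
    ∀ r ∈ S, G.Adj v r → r = p ∨ r = q
  con : ∀ v ∈ S, ∀ X : Set W, (∃ x ∈ X, x ∈ S ∧ x ≠ v) →
    (∀ x ∈ X, x ∈ S → x ≠ v → ∀ y ∈ S, y ≠ v → G.Adj x y → y ∈ X) → ∀ x ∈ S, x ≠ v → x ∈ X

def Src (G : SimpleGraph W) (A : W → W → Prop) (S : Finset W) (x : W) : Prop :=
  x ∈ S ∧ ∀ r ∈ S, G.Adj x r → A x r

def Snk (G : SimpleGraph W) (A : W → W → Prop) (S : Finset W) (x : W) : Prop :=
  x ∈ S ∧ ∀ r ∈ S, G.Adj x r → A r x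

variable {V : Type} {G : SimpleGraph W} {A : W → W → Prop} {S : Finset W}

theorem exists_src (hS : AbsHole G S) (hA : IsOrientation G A) (T : BurlingTree V) (f : W ↪ V)
    (hf : ∀ u v, A u v ↔ T.Arc (f u) (f v)) : ∃ s, Src G A S s := by
  obtain ⟨x, hx, hmin⟩ := S.exists_min_image (fun x => dep T (f x)) hS.ne
  by_cases h : Src G A S x
  · exact ⟨x, h⟩
  · unfold Src at h
    push Not at h
    obtain ⟨u, hu, hxu, hn⟩ := h hx
    have hux : A u x := by
      by_contra hc
      exact hn ((hA.2 x u hxu).2 hc)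
    refine ⟨u, hu, fun r hr hur => ?_⟩
    by_contra hc
    have hru : A r u := by
      by_contra hc'
      exact hc ((hA.2 u r hur).2 hc')
    rw [hf] at hru hux
    have h1 := arc_dep2 T hru hux
    have h2 := arc_dep T hux
    have h3 := hmin r hr
    have h4 := hmin u hu
    have h5 := hmin x hx
    obtain ⟨-, hl, -⟩ := arc_basic T hux
    have e := arc_dep T hru
    have e2 : dep T (f u) ≤ dep T (f x) := h2
    obtain ⟨p, q, -, hp, -, -⟩ := hS.nb u hu
    -- u is last-born or deeper than r
    have e3 : dep T (f x) ≤ dep T (f r) := h3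
    omega

theorem src_struct (hS : AbsHole G S) (hA : IsOrientation G A) (T : BurlingTree V) (f : W ↪ V)
    (hf : ∀ u v, A u v ↔ T.Arc (f u) (f v)) {s : W} (hs : Src G A S s) :
    ∃ y s', G.Adj s y ∧ Snk G A S y ∧ Src G A S s' ∧
      (∀ r ∈ S, G.Adj y r → r = s ∨ r = s') ∧
      ∀ x ∈ S, x = s ∨ x = s' ∨ Anc T (f y) (f x) := by
  have nadj : ∀ y z, Anc T (f y) (f z) → ¬ G.Adj y z := by
    intro y z h hadj
    by_cases hc : A y z
    · exact not_arc_down T h ((hf _ _).1 hc)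
    · have : A z y := by
        by_contra hc'
        exact hc ((hA.2 y z hadj).2 hc')
      exact not_arc_up T h ((hf _ _).1 this)
  obtain ⟨y, z, hyz, hy, hz, hsy, hsz, hanc⟩ : ∃ y z, y ≠ z ∧ y ∈ S ∧ z ∈ S ∧ G.Adj s y ∧
      G.Adj s z ∧ Anc T (f y) (f z) := by
    obtain ⟨p, q, hpq, hp, hq, hsp, hsq, -⟩ := hS.nb s hs.1
    rcases arc_comp T ((hf _ _).1 (hs.2 p hp hsp)) ((hf _ _).1 (hs.2 q hq hsq)) with h | h
    · exact ⟨p, q, hpq, hp, hq, hsp, hsq, h⟩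
    · exact ⟨q, p, hpq.symm, hq, hp, hsq, hsp, h⟩
  obtain ⟨s', hs's, hs', hys', hynb⟩ : ∃ s', s' ≠ s ∧ s' ∈ S ∧ G.Adj y s' ∧
      ∀ r ∈ S, G.Adj y r → r = s ∨ r = s' := by
    obtain ⟨p, q, hpq, hp, hq, hsp, hsq, h⟩ := hS.nb y hy
    rcases h s hs.1 hsy.symm with e | e
    · subst e; exact ⟨q, hpq.symm, hq, hsq, h⟩
    · subst e; exact ⟨p, hpq, hp, hsp, fun r hr hr' => (h r hr hr').symm⟩
  -- crossing lemma
  have cross : ∀ x ∈ S, Anc T (f y) (f x) → x ≠ y → ∀ r ∈ S, r ≠ s → G.Adj x r →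
      (Anc T (f y) (f r) ∧ r ≠ y) ∨ (r = s' ∧ A s' x ∧ A s' y) := by
    intro x hx hyx hxy r hr hrs hxr
    by_cases hyr : Anc T (f y) (f r)
    · refine Or.inl ⟨hyr, ?_⟩
      rintro rfl
      exact nadj _ _ hyx hxr.symm
    · right
      have hrx : A r x := by
        by_contra hc
        have := (hA.2 x r hxr).2 hc
        exact hxy (f.injective (arc_out T ((hf _ _).1 this) hyx hyr))
      have hry : A r y := (hf _ _).2 (arc_in T ((hf _ _).1 hrx) hyx hyr)
      rcases hynb r hr (hA.1 _ _ hry).symm with e | e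
      · exact (hrs e).elim
      · subst e; exact ⟨rfl, hrx, hry⟩
  have hex : ∃ x ∈ S, Anc T (f y) (f x) ∧ x ≠ y ∧ A s' x ∧ A s' y := by
    by_contra hc
    push Not at hc
    have := hS.con s hs.1 {x | Anc T (f y) (f x) ∧ x ≠ y}
      ⟨z, ⟨hanc, hyz.symm⟩, hz, hsz.ne.symm⟩ ?_ y hy hsy.ne.symm
    · exact this.2 rfl
    · rintro x ⟨hx1, hx2⟩ hxS hxs r hr hrs hxr
      rcases cross x hxS hx1 hx2 r hr hrs hxr with h | ⟨-, h1, h2⟩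
      · exact h
      · exact (hc x hxS hx1 hx2 h1 h2).elim
  obtain ⟨x, hxS, hyx, hxy, hsx, hs'y⟩ := hex
  have hs'nb : ∀ r ∈ S, G.Adj s' r → r = x ∨ r = y := by
    obtain ⟨p, q, hpq, hp, hq, hsp, hsq, h⟩ := hS.nb s' hs'
    have h1 := h x hxS (hA.1 _ _ hsx)
    have h2 := h y hy (hA.1 _ _ hs'y)
    intro r hr hr'
    have h3 := h r hr hr'
    grind
  refine ⟨y, s', hsy, ⟨hy, ?_⟩, ⟨hs', ?_⟩, hynb, ?_⟩
  · intro r hr hr'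
    rcases hynb r hr hr' with rfl | rfl
    · exact hs.2 y hy hsy
    · exact hs'y
  · intro r hr hr'
    rcases hs'nb r hr hr' with rfl | rfl
    · exact hsx
    · exact hs'y
  · intro w hw
    by_cases hws : w = s
    · exact Or.inl hws
    right
    refine hS.con s hs.1 {x | x = s' ∨ Anc T (f y) (f x)}
      ⟨z, Or.inr hanc, hz, hsz.ne.symm⟩ ?_ w hw hws
    intro v hv hvS hvs r hr hrs hvr
    by_cases hvy : v = y
    · subst hvy
      rcases hynb r hr hvr with e | e
      · exact (hrs e).elim
      · exact Or.inl e
    rcases hv with rfl | hv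
    · rcases hs'nb r hr hvr with rfl | rfl
      · exact Or.inr hyx
      · exact Or.inr (Anc.refl T _)
    · rcases cross v hvS hv hvy r hr hrs hvr with h | h
      · exact Or.inr h.1
      · exact Or.inl h.1

theorem abs_main (hS : AbsHole G S) (hB : IsOrientedBurling G A) :
    ∃ s y s' t, G.Adj s y ∧ Src G A S s ∧ Snk G A S y ∧
      ∀ x, Src G A S x ∨ Snk G A S x → x = s ∨ x = y ∨ x = s' ∨ x = t := by
  classical
  obtain ⟨hA, V, T, f, hf⟩ := hB
  obtain ⟨s, hs⟩ := exists_src hS hA T f hf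
  obtain ⟨y, s', hsy, hy, hs', hynb, hall⟩ := src_struct hS hA T f hf hs
  have not_both : ∀ x, Src G A S x → Snk G A S x → False := by
    intro x h1 h2
    obtain ⟨p, q, -, hp, -, hxp, -⟩ := hS.nb x h1.1
    exact (hA.2 x p hxp).1 (h1.2 p hp hxp) (h2.2 p hp hxp)
  have hsrc : ∀ x, Src G A S x → x = s ∨ x = s' := by
    intro x hx
    by_contra hc
    push Not at hc
    obtain ⟨y2, x2, hxy2, hy2, hx2, hynb2, hall2⟩ := src_struct hS hA T f hf hx
    have h1 : Anc T (f y2) (f y) := by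
      rcases hall2 y hy.1 with e | e | e
      · subst e; exact (not_both _ hx hy).elim
      · subst e; exact (not_both _ hx2 hy).elim
      · exact e
    have h2 : Anc T (f y) (f y2) := by
      rcases hall y2 hy2.1 with e | e | e
      · subst e; exact (not_both _ hs hy2).elim
      · subst e; exact (not_both _ hs' hy2).elim
      · exact e
    have e : y = y2 := f.injective (Anc.eq_of_dep T h2 h1.dep_le)
    subst e
    rcases hynb x hx.1 hxy2.symm with e | e
    · exact hc.1 e
    · exact hc.2 e
  have hsnk : ∀ t t', Snk G A S t → Snk G A S t' → t ≠ y → t' ≠ y → t = t' := by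
    intro t t' ht ht' hty ht'y
    by_contra hne
    let F : W → W → ℤ := fun v w => if A v w then 1 else 0
    have h0 : ∑ v ∈ S, ∑ w ∈ S, (F v w - F w v) = 0 := by
      simp only [Finset.sum_sub_distrib]
      rw [sub_eq_zero, Finset.sum_comm]
    have hasym : ∀ u v, A u v → ¬ A v u := fun u v h => (hA.2 u v (hA.1 u v h)).1 h
    have hpt : ∀ v ∈ S, ∑ w ∈ S, (F v w - F w v) ≤
        (if v = s then 2 else 0) + (if v = s' then 2 else 0) - (if v = y then 2 else 0)
        - (if v = t then 2 else 0) - (if v = t' then 2 else 0) := by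
      intro v hv
      obtain ⟨p, q, hpq, hp, hq, hvp, hvq, h⟩ := hS.nb v hv
      have hsum : ∑ w ∈ S, (F v w - F w v) = ∑ w ∈ {p, q}, (F v w - F w v) := by
        symm
        apply Finset.sum_subset
        · intro x; simp; rintro (rfl | rfl) <;> assumption
        · intro x hx hx'
          have : ¬ G.Adj v x := fun h' => hx' (by simpa using h x hx h')
          have a1 : ¬ A v x := fun h' => this (hA.1 _ _ h')
          have a2 : ¬ A x v := fun h' => this (hA.1 _ _ h').symm
          simp [F, a1, a2]
      rw [hsum, Finset.sum_pair hpq]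
      have op := hA.2 v p hvp
      have oq := hA.2 v q hvq
      by_cases hsv : Src G A S v
      · have n1 : v ≠ y := by rintro rfl; exact not_both _ hsv hy
        have n2 : v ≠ t := by rintro rfl; exact not_both _ hsv ht
        have n3 : v ≠ t' := by rintro rfl; exact not_both _ hsv ht'
        have a1 := hsv.2 p hp hvp
        have a2 := hsv.2 q hq hvq
        have a3 := hsrc v hsv
        simp only [F, a1, a2, hasym _ _ a1, hasym _ _ a2, n1, n2, n3]
        grind
      · have m1 : v ≠ s := by rintro rfl; exact hsv hs
        have m2 : v ≠ s' := by rintro rfl; exact hsv hs'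
        by_cases hsk : Snk G A S v
        · have a1 := hsk.2 p hp hvp
          have a2 := hsk.2 q hq hvq
          simp only [F, a1, a2, hasym _ _ a1, hasym _ _ a2, m1, m2]
          grind
        · have n1 : v ≠ y := by rintro rfl; exact hsk hy
          have n2 : v ≠ t := by rintro rfl; exact hsk ht
          have n3 : v ≠ t' := by rintro rfl; exact hsk ht'
          have b : ¬ (A v p ∧ A v q) := by
            rintro ⟨b1, b2⟩
            refine hsv ⟨hv, fun r hr hr' => ?_⟩
            rcases h r hr hr' with rfl | rfl <;> assumption
          simp only [F, m1, m2, n1, n2, n3]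
          grind
    have := Finset.sum_le_sum hpt
    rw [h0] at this
    simp only [Finset.sum_sub_distrib, Finset.sum_add_distrib, Finset.sum_ite_eq', hs.1, hs'.1,
      hy.1, ht.1, ht'.1] at this
    norm_num at this
  by_cases hex : ∃ t, Snk G A S t ∧ t ≠ y
  · obtain ⟨t, ht, hty⟩ := hex
    refine ⟨s, y, s', t, hsy, hs, hy, ?_⟩
    rintro x (hx | hx)
    · rcases hsrc x hx with h | h <;> simp [h]
    · by_cases hxy : x = y
      · simp [hxy]
      · simp [hsnk x t hx ht hxy hty]
  · refine ⟨s, y, s', y, hsy, hs, hy, ?_⟩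
    push Not at hex
    rintro x (hx | hx)
    · rcases hsrc x hx with h | h <;> simp [h]
    · simp [hex x hx]

end AbsHole
section HoleWalk
variable {W : Type} {G : SimpleGraph W}

open Classical in
theorem absHole_of_isHole {v₀ : W} {c : G.Walk v₀ v₀} (hc : IsHole G c) :
    AbsHole G c.support.toFinset := by
  have key : ∀ v ∈ c.support, ∃ d : G.Walk v v, d.IsCycle ∧
      (∀ x, x ∈ d.support ↔ x ∈ c.support) ∧ (∀ e, e ∈ d.edges ↔ e ∈ c.edges) := by
    intro v hv
    exact ⟨c.rotate v hv, hc.1.1.rotate hv, fun x => Walk.mem_support_rotate_iff c v hv,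
      fun e => (c.rotate_edges v hv).perm.mem_iff⟩
  refine ⟨⟨v₀, by simp⟩, ?_, ?_⟩
  · intro v hv
    simp only [List.mem_toFinset] at hv ⊢
    obtain ⟨d, hd, hds, hde⟩ := key v hv
    have hn := hd.neighborSet_toSubgraph_endpoint
    refine ⟨d.snd, d.penultimate, hd.snd_ne_penultimate, (hds _).1 (d.getVert_mem_support _),
      (hds _).1 (d.getVert_mem_support _), d.adj_snd hd.not_nil,
      (d.adj_penultimate hd.not_nil).symm, ?_⟩
    intro r hr hvr
    have : r ∈ d.toSubgraph.neighborSet v := by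
      rw [Subgraph.mem_neighborSet, Walk.adj_toSubgraph_iff_mem_edges, hde]
      exact hc.1.2 v r hv hr hvr
    rw [hn] at this
    simpa using this
  · intro v hv X hX hcl
    simp only [List.mem_toFinset] at hv hX hcl ⊢
    obtain ⟨d, hd, hds, hde⟩ := key v hv
    have hne : ∀ i, 0 < i → i < d.length → d.getVert i ≠ v := by
      intro i hi hi' h
      have := (hd.getVert_endpoint_iff hi'.le).1 h
      omega
    have hidx : ∀ x ∈ c.support, x ≠ v → ∃ i, 0 < i ∧ i < d.length ∧ d.getVert i = x := by
      intro x hx hxv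
      rw [← hds, Walk.mem_support_iff_exists_getVert] at hx
      obtain ⟨i, hi, hi'⟩ := hx
      refine ⟨i, ?_, ?_, hi⟩
      · rcases Nat.eq_zero_or_pos i with rfl | h
        · simp at hi; exact (hxv hi.symm).elim
        · exact h
      · rcases hi'.lt_or_eq with h | rfl
        · exact h
        · simp at hi; exact (hxv hi.symm).elim
    have hmem : ∀ i, d.getVert i ∈ c.support := fun i => (hds _).1 (d.getVert_mem_support i)
    have hup : ∀ i, 0 < i → i + 1 < d.length → (d.getVert i ∈ X ↔ d.getVert (i+1) ∈ X) := by
      intro i hi hi'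
      have ha := d.adj_getVert_succ (i := i) (by omega)
      exact ⟨fun h => hcl _ h (hmem _) (hne _ hi (by omega)) _ (hmem _) (hne _ (by omega) hi') ha,
        fun h => hcl _ h (hmem _) (hne _ (by omega) hi') _ (hmem _) (hne _ hi (by omega)) ha.symm⟩
    have hall : ∀ i, 0 < i → i < d.length → (d.getVert i ∈ X ↔ d.getVert 1 ∈ X) := by
      intro i hi
      induction i, hi using Nat.le_induction with
      | base => simp
      | succ k hk ih =>
        intro h
        rw [← hup k hk h]
        exact ih (by omega)
    obtain ⟨x, hxX, hxS, hxv⟩ := hX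
    obtain ⟨i, hi, hi', rfl⟩ := hidx x hxS hxv
    intro w hw hwv
    obtain ⟨j, hj, hj', rfl⟩ := hidx w hw hwv
    rw [hall j hj hj', ← hall i hi hi']
    exact hxX

theorem hole_main {v₀ : W} {c : G.Walk v₀ v₀} (hc : IsHole G c) {A : W → W → Prop}
    (hB : IsOrientedBurling G A) :
    ∃ s y s' t, G.Adj s y ∧ IsHoleExtremum A c s ∧ IsHoleExtremum A c y ∧
      ∀ x, IsHoleExtremum A c x → x = s ∨ x = y ∨ x = s' ∨ x = t := by
  classical
  obtain ⟨s, y, s', t, h1, h2, h3, h4⟩ := abs_main (absHole_of_isHole hc) hB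
  have e1 : ∀ x, Src G A c.support.toFinset x ↔ IsHoleSource A c x := by
    intro x
    simp only [Src, IsHoleSource, List.mem_toFinset]
    refine ⟨fun h => ⟨h.1, fun y hy => h.2 y (Walk.snd_mem_support_of_mem_edges c hy)
      (c.adj_of_mem_edges hy)⟩, fun h => ⟨h.1, fun r hr hr' => h.2 r (hc.1.2 _ _ h.1 hr hr')⟩⟩
  have e2 : ∀ x, Snk G A c.support.toFinset x ↔ IsHoleSink A c x := by
    intro x
    simp only [Snk, IsHoleSink, List.mem_toFinset]
    refine ⟨fun h => ⟨h.1, fun y hy => h.2 y (Walk.snd_mem_support_of_mem_edges c hy)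
      (c.adj_of_mem_edges hy)⟩, fun h => ⟨h.1, fun r hr hr' => h.2 r (hc.1.2 _ _ h.1 hr hr')⟩⟩
  simp only [e1, e2] at h2 h3 h4
  exact ⟨s, y, s', t, h1, Or.inl h2, Or.inr h3, h4⟩

theorem isPath_append_of {u v w : W} {p : G.Walk u v} {q : G.Walk v w} (hp : p.IsPath)
    (hq : q.IsPath) (h : ∀ x, x ∈ p.support → x ∈ q.support → x = v) : (p.append q).IsPath := by
  rw [Walk.isPath_def, Walk.support_append, List.nodup_append']
  refine ⟨hp.support_nodup, hq.support_nodup.tail, ?_⟩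
  intro x hx hx'
  have := h x hx (List.mem_of_mem_tail hx')
  subst this
  have hn := hq.support_nodup
  rw [← Walk.cons_tail_support] at hn
  exact (List.nodup_cons.1 hn).1 hx'

theorem isCycle_append_of {u v : W} {p : G.Walk u v} {q : G.Walk v u} (hp : p.IsPath)
    (hq : q.IsPath) (h : ∀ x, x ∈ p.support → x ∈ q.support → x = u ∨ x = v)
    (hl : 1 < p.length) : (p.append q).IsCycle := by
  refine hp.isCycle_append hq ?_ (Or.inl hl)
  intro x hx hx'
  rcases h x (List.mem_of_mem_tail hx) (List.mem_of_mem_tail hx') with rfl | rfl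
  · have hn := hp.support_nodup
    rw [← Walk.cons_tail_support] at hn
    exact (List.nodup_cons.1 hn).1 hx
  · have hn := hq.support_nodup
    rw [← Walk.cons_tail_support] at hn
    exact (List.nodup_cons.1 hn).1 hx'

theorem cyc_concat {m : ℕ} (hm : 4 ≤ m) (a : ZMod m → W) (Q : ∀ i, G.Walk (a i) (a (i + 1)))
    (hQ : ∀ i, (Q i).IsPath) (hlen : ∀ i, 1 ≤ (Q i).length)
    (hd : ∀ i j, i ≠ j → ∀ x, x ∈ (Q i).support → x ∈ (Q j).support →
      (j = i + 1 ∧ x = a j) ∨ (i = j + 1 ∧ x = a i)) :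
    ∃ (v : W) (c : G.Walk v v), c.IsCycle ∧ 4 ≤ c.length ∧
      (∀ x, x ∈ c.support ↔ ∃ i, x ∈ (Q i).support) ∧
      (∀ e, e ∈ c.edges ↔ ∃ i, e ∈ (Q i).edges) := by
  have hcast : ∀ i j : ℕ, i < m → j < m → (i : ZMod m) = j → i = j := by
    intro i j hi hj h
    rw [ZMod.natCast_eq_natCast_iff'] at h
    rwa [Nat.mod_eq_of_lt hi, Nat.mod_eq_of_lt hj] at h
  have key : ∀ n : ℕ, 1 ≤ n → n < m → ∃ R : G.Walk (a ((0:ℕ) : ZMod m)) (a (n : ZMod m)),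
      R.IsPath ∧ n ≤ R.length ∧
      (∀ x, x ∈ R.support ↔ ∃ k : ℕ, k < n ∧ x ∈ (Q (k : ZMod m)).support) ∧
      (∀ e, e ∈ R.edges ↔ ∃ k : ℕ, k < n ∧ e ∈ (Q (k : ZMod m)).edges) := by
    intro n hn
    induction n, hn using Nat.le_induction with
    | base =>
      intro _
      refine ⟨(Q ((0:ℕ) : ZMod m)).copy rfl (by simp), by simpa using hQ _, by simpa using hlen _, ?_, ?_⟩
      · simp
      · simp
    | succ n hn ih =>
      intro hnm
      obtain ⟨R, hR, hRl, hRs, hRe⟩ := ih (by omega)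
      have hW : ((n : ZMod m) + 1) = ((n + 1 : ℕ) : ZMod m) := by push_cast; rfl
      refine ⟨(R.append (Q n)).copy rfl (by rw [hW]), ?_, ?_, ?_, ?_⟩
      · rw [Walk.isPath_copy]
        refine isPath_append_of hR (hQ _) ?_
        intro x hx hx'
        obtain ⟨k, hk, hkx⟩ := (hRs x).1 hx
        rcases hd k n (fun h => by have := hcast _ _ (by omega) (by omega) h; omega) x hkx hx' with h | h
        · exact h.2
        · exfalso
          have := hcast k (n + 1) (by omega) (by omega) (by rw [h.1]; push_cast; rfl)
          omega
      · have := hlen n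
        simp; omega
      · intro x
        rw [Walk.support_copy, Walk.mem_support_append_iff, hRs]
        simp only [Nat.lt_succ_iff_lt_or_eq, or_and_right, exists_or, exists_eq_left]
      · intro x
        rw [Walk.edges_copy, Walk.edges_append, List.mem_append, hRe]
        simp only [Nat.lt_succ_iff_lt_or_eq, or_and_right, exists_or, exists_eq_left]
  obtain ⟨R, hR, hRl, hRs, hRe⟩ := key (m - 1) (by omega) (by omega)
  have hm1 : (((m - 1 : ℕ) : ZMod m) + 1) = ((0 : ℕ) : ZMod m) := by
    have : ((m - 1 + 1 : ℕ) : ZMod m) = 0 := by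
      rw [Nat.sub_add_cancel (by omega)]; simp
    push_cast at this ⊢
    exact this
  have : NeZero m := ⟨by omega⟩
  have hz : ∀ i : ZMod m, ∃ k : ℕ, k < m ∧ (k : ZMod m) = i := fun i =>
    ⟨i.val, i.val_lt, by simp⟩
  refine ⟨_, R.append ((Q ((m - 1 : ℕ) : ZMod m)).copy rfl (by rw [hm1])), ?_, ?_, ?_, ?_⟩
  · refine isCycle_append_of hR (by simpa using hQ _) ?_ (by omega)
    intro x hx hx'
    rw [Walk.support_copy] at hx'
    obtain ⟨k, hk, hkx⟩ := (hRs x).1 hx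
    rcases hd k (m-1 : ℕ) (fun h => by have := hcast _ _ (by omega) (by omega) h; omega) x hkx hx' with h | h
    · exact Or.inr h.2
    · left; rw [h.2, h.1, hm1]
  · have := hlen ((m - 1 : ℕ) : ZMod m)
    simp only [Walk.length_append, Walk.length_copy]; omega
  · intro x
    rw [Walk.mem_support_append_iff, Walk.support_copy, hRs]
    constructor
    · rintro (⟨k, -, h⟩ | h)
      · exact ⟨_, h⟩
      · exact ⟨_, h⟩
    · rintro ⟨i, hi⟩
      obtain ⟨k, hk, rfl⟩ := hz i
      by_cases hk' : k = m - 1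
      · subst hk'; exact Or.inr hi
      · exact Or.inl ⟨k, by omega, hi⟩
  · intro x
    rw [Walk.edges_append, List.mem_append, Walk.edges_copy, hRe]
    constructor
    · rintro (⟨k, -, h⟩ | h)
      · exact ⟨_, h⟩
      · exact ⟨_, h⟩
    · rintro ⟨i, hi⟩
      obtain ⟨k, hk, rfl⟩ := hz i
      by_cases hk' : k = m - 1
      · subst hk'; exact Or.inr hi
      · exact Or.inl ⟨k, by omega, hi⟩

end HoleWalk
section Neck
variable {V : Type} {G : SimpleGraph V} {m : ℕ} (N : Necklace G m)

theorem neck_bb {i j : ZMod m} (h : i ≠ j) {x : V} (hi : x ∈ (N.B i).support)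
    (hj : x ∈ (N.B j).support) : x = N.a i ∨ x = N.b i := by
  rcases N.bead_disjoint i j h x hi hj with h | h
  · exact Or.inr h.2.1
  · exact Or.inl h.2.2

theorem neck_bp {i j : ZMod m} {x : V} (hi : x ∈ (N.B i).support)
    (hj : x ∈ (N.P j).support) : (j = i ∧ x = N.b i) ∨ (i = j + 1 ∧ x = N.a i) := by
  rcases N.path_bead_disjoint j i x hj hi with h | h
  · by_cases hij : i = j
    · subst hij; exact Or.inl ⟨rfl, h⟩
    · rcases N.bead_disjoint i j hij x hi (h ▸ N.b_mem j) with h' | h'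
      · exact (N.ab_ne j (h'.2.2.symm.trans h)).elim
      · exact Or.inr ⟨h'.1, h'.2.2⟩
  · by_cases hij : i = j + 1
    · subst hij; exact Or.inr ⟨rfl, h⟩
    · rcases N.bead_disjoint i (j + 1) hij x hi (h ▸ (N.B (j + 1)).start_mem_support) with h' | h'
      · exact Or.inl ⟨add_right_cancel h'.1, h'.2.1⟩
      · exact (N.ab_ne (j + 1) (h.symm.trans h'.2.1)).elim

theorem neck_pp {i j : ZMod m} (hij : i ≠ j) {x : V} (hi : x ∈ (N.P i).support)
    (hj : x ∈ (N.P j).support) : False := by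
  rcases (N.path_disjoint i j hij x hi hj).1 with h | h
  · rcases neck_bp N (i := i) (h ▸ N.b_mem i) hj with h' | h'
    · exact hij h'.1.symm
    · exact N.ab_ne i (h'.2.symm.trans h)
  · rcases neck_bp N (i := i + 1) (h ▸ (N.B (i + 1)).start_mem_support) hj with h' | h'
    · exact N.ab_ne (i + 1) (h.symm.trans h'.2)
    · exact hij (add_right_cancel h'.1)

theorem neck_ends {i : ZMod m} {x y : V} (hadj : G.Adj x y) (hx : x = N.a i ∨ x = N.b i)
    (hy : y = N.a i ∨ y = N.b i) : False := by
  have := N.ab_nonadj i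
  rcases hx with rfl | rfl <;> rcases hy with rfl | rfl
  · exact hadj.ne rfl
  · exact this hadj
  · exact this hadj.symm
  · exact hadj.ne rfl

/-- An edge is in `B i` as soon as one end is an interior vertex of the bead. -/
theorem neck_priv {i : ZMod m} {x y : V} (hx : x ∈ (N.B i).support) (ha : x ≠ N.a i)
    (hb : x ≠ N.b i) (hadj : G.Adj x y) : s(x, y) ∈ (N.B i).edges := by
  rcases N.cover_edge x y hadj with ⟨j, hj⟩ | ⟨j, hj⟩
  · by_cases hij : i = j
    · subst hij; exact hj
    · have := neck_bb N hij hx (Walk.fst_mem_support_of_mem_edges _ hj)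
      tauto
  · have := neck_bp N hx (Walk.fst_mem_support_of_mem_edges _ hj)
    tauto

theorem neck_bead_hole (i : ZMod m) : IsHole G (N.B i) := by
  refine ⟨⟨N.B_cycle i, ?_⟩, N.B_len i⟩
  intro x y hx hy hadj
  by_contra hc
  refine neck_ends N (i := i) hadj ?_ ?_
  · by_contra h
    push Not at h
    exact hc (neck_priv N hx h.1 h.2 hadj)
  · by_contra h
    push Not at h
    have := neck_priv N hy h.1 h.2 hadj.symm
    rw [Sym2.eq_swap] at this
    exact hc this

theorem neck_ext {A : V → V → Prop} (hB : IsOrientedBurling G A) (i : ZMod m) :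
    ∃ e, IsHoleExtremum A (N.B i) e ∧ e ≠ N.a i ∧ e ≠ N.b i := by
  obtain ⟨s, y, -, -, hsy, hs, hy, -⟩ := hole_main (neck_bead_hole N i) hB
  by_contra hc
  push Not at hc
  refine neck_ends N (i := i) hsy ?_ ?_
  · have := hc s hs; tauto
  · have := hc y hy; tauto

theorem neck_side (i : ZMod m) {e : V} (he : e ∈ (N.B i).support) :
    ∃ Q Q' : G.Walk (N.a i) (N.b i), Q.IsPath ∧ e ∈ Q.support ∧
      (∀ x, x ∈ (N.B i).support ↔ x ∈ Q.support ∨ x ∈ Q'.support) ∧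
      (∀ x, x ∈ (N.B i).edges ↔ x ∈ Q.edges ∨ x ∈ Q'.edges) ∧
      (∀ x, x ∈ Q.support → x ∈ Q'.support → x = N.a i ∨ x = N.b i) := by
  classical
  have hb := N.b_mem i
  have hspec := (N.B i).take_spec hb
  have hcyc := N.B_cycle i
  set p := (N.B i).takeUntil _ hb
  set q := (N.B i).dropUntil _ hb
  rw [← hspec] at hcyc
  have hp : p.IsPath := hcyc.isPath_of_append_left (Walk.not_nil_of_ne (N.ab_ne i).symm)
  have hq : q.IsPath := hcyc.isPath_of_append_right (Walk.not_nil_of_ne (N.ab_ne i))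
  have hdis : ∀ x, x ∈ p.support → x ∈ q.support → x = N.a i ∨ x = N.b i := by
    intro x hx hx'
    have hn := hcyc.support_nodup
    rw [Walk.tail_support_append, List.nodup_append'] at hn
    rw [← Walk.cons_tail_support, List.mem_cons] at hx hx'
    rcases hx with h | h
    · exact Or.inl h
    rcases hx' with h' | h'
    · exact Or.inr h'
    exact (hn.2.2 h h').elim
  have hs : ∀ x, x ∈ (N.B i).support ↔ x ∈ p.support ∨ x ∈ q.support := by
    intro x; rw [← hspec, Walk.mem_support_append_iff]
  have hed : ∀ x, x ∈ (N.B i).edges ↔ x ∈ p.edges ∨ x ∈ q.edges := by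
    intro x; rw [← hspec, Walk.edges_append, List.mem_append]
  clear_value p q
  rcases (hs e).1 he with h | h
  · refine ⟨p, q.reverse, hp, h, ?_, ?_, ?_⟩
    · simpa using hs
    · simpa using hed
    · simpa using hdis
  · refine ⟨q.reverse, p, hq.reverse, by simpa using h, ?_, ?_, ?_⟩
    · intro x; rw [hs]; simp [or_comm]
    · intro x; rw [hed]; simp [or_comm]
    · intro x h1 h2; exact hdis x h2 (by simpa using h1)

theorem neck_big (hm : 4 ≤ m) (e : ZMod m → V) (he : ∀ i, e i ∈ (N.B i).support) :
    ∃ (v : V) (c : G.Walk v v), IsHole G c ∧ ∀ i, e i ∈ c.support := by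
  choose Q Q' hQ heQ hs hed hdis using fun i => neck_side N i (he i)
  have hone : ∀ i : ZMod m, i ≠ i + 1 := by
    intro i h
    have h1 : ((1 : ℕ) : ZMod m) = ((0 : ℕ) : ZMod m) := by
      push_cast
      exact (add_eq_left.1 h.symm)
    rw [ZMod.natCast_eq_natCast_iff', Nat.mod_eq_of_lt (by omega), Nat.mod_eq_of_lt (by omega)] at h1
    omega
  have htwo : ∀ i : ZMod m, i ≠ i + 1 + 1 := by
    intro i h
    have h1 : ((2 : ℕ) : ZMod m) = ((0 : ℕ) : ZMod m) := by
      push_cast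
      rw [add_assoc, one_add_one_eq_two] at h
      exact (add_eq_left.1 h.symm)
    rw [ZMod.natCast_eq_natCast_iff', Nat.mod_eq_of_lt (by omega), Nat.mod_eq_of_lt (by omega)] at h1
    omega
  have hQB : ∀ i x, x ∈ (Q i).support → x ∈ (N.B i).support := fun i x h => (hs i x).2 (Or.inl h)
  have hab : ∀ i, N.a (i + 1) ∈ (N.B i).support → N.a (i + 1) = N.b i := by
    intro i h
    rcases N.bead_disjoint i (i + 1) (hone i) _ h (Walk.start_mem_support _) with h' | h'
    · exact h'.2.1
    · exact (htwo i h'.1).elim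
  have key := cyc_concat hm N.a (fun i => (Q i).append (N.P i))
  specialize key ?_ ?_ ?_
  · intro i
    refine isPath_append_of (hQ i) (N.P_path i) ?_
    intro x hx hx'
    rcases neck_bp N (hQB i x hx) hx' with h | h
    · exact h.2
    · exact (hone i h.1).elim
  · intro i
    rw [Walk.length_append]
    have : (Q i).length ≠ 0 := fun h => N.ab_ne i (Walk.eq_of_length_eq_zero h)
    omega
  · intro i j hij x hi hj
    rw [Walk.mem_support_append_iff] at hi hj
    rcases hi with hi | hi <;> rcases hj with hj | hj
    · rcases N.bead_disjoint i j hij x (hQB _ _ hi) (hQB _ _ hj) with h | h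
      · exact Or.inl ⟨h.1, h.2.2⟩
      · exact Or.inr ⟨h.1, h.2.2⟩
    · rcases neck_bp N (hQB _ _ hi) hj with h | h
      · exact (hij h.1.symm).elim
      · exact Or.inr h
    · rcases neck_bp N (hQB _ _ hj) hi with h | h
      · exact (hij h.1).elim
      · exact Or.inl h
    · exact (neck_pp N hij hi hj).elim
  obtain ⟨v, c, hc, hcl, hcs, hce⟩ := key
  · refine ⟨v, c, ⟨⟨hc, ?_⟩, hcl⟩, ?_⟩
    · have hin : ∀ i x, x ∈ c.support → x ∈ (Q' i).support → x = N.a i ∨ x = N.b i := by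
        intro i x hx hx'
        obtain ⟨j, hj⟩ := (hcs x).1 hx
        rw [Walk.mem_support_append_iff] at hj
        have hxB : x ∈ (N.B i).support := (hs i x).2 (Or.inr hx')
        rcases hj with hj | hj
        · by_cases hij : i = j
          · subst hij; exact hdis i x hj hx'
          · exact neck_bb N hij hxB (hQB j x hj)
        · have := neck_bp N hxB hj
          tauto
      intro x y hx hy hadj
      rw [hce]
      simp only [Walk.edges_append, List.mem_append]
      rcases N.cover_edge x y hadj with ⟨i, hi⟩ | ⟨i, hi⟩
      · rcases (hed i _).1 hi with h | h
        · exact ⟨i, Or.inl h⟩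
        · exact (neck_ends N hadj (hin i x hx (Walk.fst_mem_support_of_mem_edges _ h))
            (hin i y hy (Walk.snd_mem_support_of_mem_edges _ h))).elim
      · exact ⟨i, Or.inr hi⟩
    · intro i
      rw [hcs]
      exact ⟨i, (Walk.mem_support_append_iff _ _).2 (Or.inl (heQ i))⟩

end Neck

/-- no `m`-necklace with `m ≥ 4` is a Burling graph. -/
theorem necklace_not_Burling (V : Type) (G : SimpleGraph V) (m : ℕ) (N : Necklace G m)
    (hm : 4 ≤ m) : ¬ IsBurlingGraph G := by
  classical
  rintro ⟨A, hB⟩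
  choose e he hea heb using neck_ext N hB
  have heB : ∀ i, e i ∈ (N.B i).support := fun i => by
    rcases he i with h | h <;> exact h.1
  obtain ⟨v, c, hc, hec⟩ := neck_big N hm e heB
  obtain ⟨s, y, s', t, hsy, -, -, hall⟩ := hole_main hc hB
  have hext : ∀ i, IsHoleExtremum A c (e i) := by
    intro i
    have hp : ∀ z, s(e i, z) ∈ c.edges → s(e i, z) ∈ (N.B i).edges := fun z hz =>
      neck_priv N (heB i) (hea i) (heb i) (c.adj_of_mem_edges hz)
    rcases he i with h | h
    · exact Or.inl ⟨hec i, fun z hz => h.2 z (hp z hz)⟩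
    · exact Or.inr ⟨hec i, fun z hz => h.2 z (hp z hz)⟩
  have hnot : ∀ i j, i ≠ j → e j ∉ (N.B i).support := by
    intro i j hij h
    rcases neck_bb N hij.symm (heB j) h with h' | h'
    · exact hea j h'
    · exact heb j h'
  have hinj : Function.Injective e := by
    intro i j h
    by_contra hij
    exact hnot i j hij (h ▸ heB i)
  have : NeZero m := ⟨by omega⟩
  have hsub : Finset.univ.image e ⊆ {s, y, s', t} := by
    intro x hx
    simp only [Finset.mem_image, Finset.mem_univ, true_and] at hx
    obtain ⟨i, rfl⟩ := hx
    simpa using hall _ (hext i)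
  have hcard : (Finset.univ.image e).card = m := by
    rw [Finset.card_image_of_injective _ hinj, Finset.card_univ, ZMod.card]
  have heq := Finset.eq_of_subset_of_card_le hsub (by
    rw [hcard]; exact Finset.card_le_four.trans hm)
  have h1 : s ∈ Finset.univ.image e := by rw [heq]; simp
  have h2 : y ∈ Finset.univ.image e := by rw [heq]; simp
  simp only [Finset.mem_image, Finset.mem_univ, true_and] at h1 h2
  obtain ⟨i, rfl⟩ := h1
  obtain ⟨j, rfl⟩ := h2
  have hij : i ≠ j := by rintro rfl; exact hsy.ne rfl
  exact hnot i j hij (Walk.snd_mem_support_of_mem_edges _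
    (neck_priv N (heB i) (hea i) (heb i) hsy))

end BurlingFormal
end

section
/- Every m-necklace with m ≥ 4 is not weakly pervasive. -/
namespace BurlingFormal

open SimpleGraph

structure BRel {U : Type} (S : SimpleGraph U) (arc lt : U → U → Prop) (rk : U → ℕ) : Prop where
  adj_iff : ∀ u v, S.Adj u v ↔ (arc u v ∨ arc v u)
  A1 : ∀ u v, arc u v → rk v < rk u
  A2 : ∀ w u v, arc w u → arc w v → u ≠ v → lt u v ∨ lt v u
  A3 : ∀ u v w, lt u v → arc u w → lt w v
  A4 : ∀ u v w, lt u v → arc w u → lt w v ∨ arc w v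
  A5 : ∀ x y, arc x y → ¬ lt y x
  A6 : ∀ x y, lt x y → ¬ lt y x

namespace BRel
variable {U : Type} {S : SimpleGraph U} {arc lt : U → U → Prop} {rk : U → ℕ}

theorem lt_irrefl (h : BRel S arc lt rk) (x : U) : ¬ lt x x := fun hx => h.A6 x x hx hx

theorem arc_irrefl (h : BRel S arc lt rk) (x : U) : ¬ arc x x := fun hx =>
  Nat.lt_irrefl _ (h.A1 x x hx)

theorem arc_not_lt (h : BRel S arc lt rk) {x y : U} (hxy : arc x y) : ¬ lt x y := fun hl =>
  h.lt_irrefl y (h.A3 x y y hl hxy)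

theorem not_adj (h : BRel S arc lt rk) {u z : U} (hl : lt u z) : ¬ S.Adj u z := by
  intro ha
  rcases (h.adj_iff _ _).1 ha with h1 | h1
  · exact h.arc_not_lt h1 hl
  · exact h.A5 _ _ h1 hl

theorem spread (h : BRel S arc lt rk) {u u' z : U} (hl : lt u z) (ha : S.Adj u u')
    (hn : ¬ arc u' z) : lt u' z := by
  rcases (h.adj_iff _ _).1 ha with h1 | h1
  · exact h.A3 _ _ _ hl h1
  · exact (h.A4 _ _ _ hl h1).resolve_right hn

theorem nocomp (h : BRel S arc lt rk) {x y : U} (h1 : arc x y ∨ lt x y) (h2 : arc y x ∨ lt y x) :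
    False := by
  rcases h1 with h1 | h1 <;> rcases h2 with h2 | h2
  · exact absurd (h.A1 _ _ h1) (by have := h.A1 _ _ h2; omega)
  · exact h.A5 _ _ h1 h2
  · exact h.A5 _ _ h2 h1
  · exact h.A6 _ _ h1 h2

theorem comap (h : BRel S arc lt rk) {U' : Type} {S' : SimpleGraph U'} (f : U' ↪ U)
    (hf : ∀ a b, S'.Adj a b ↔ S.Adj (f a) (f b)) :
    BRel S' (fun x y => arc (f x) (f y)) (fun x y => lt (f x) (f y)) (fun x => rk (f x)) where
  adj_iff u v := by rw [hf, h.adj_iff]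
  A1 u v := h.A1 _ _
  A2 w u v h1 h2 h3 := h.A2 _ _ _ h1 h2 (fun e => h3 (f.injective e))
  A3 u v w := h.A3 _ _ _
  A4 u v w := h.A4 _ _ _
  A5 _ _ := h.A5 _ _
  A6 _ _ := h.A6 _ _

theorem no_triangle (h : BRel S arc lt rk) {x y z : U} (hxy : S.Adj x y) (hyz : S.Adj y z)
    (hxz : S.Adj x z) : False := by
  have key : ∀ x y z, arc x y → arc x z → S.Adj y z → False := by
    intro x y z h1 h2 h3
    rcases h.A2 x y z h1 h2 h3.ne with h4 | h4
    · exact h.not_adj h4 h3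
    · exact h.not_adj h4 h3.symm
  rcases (h.adj_iff _ _).1 hxy with a | a <;> rcases (h.adj_iff _ _).1 hyz with b | b <;>
    rcases (h.adj_iff _ _).1 hxz with c | c
  · exact key _ _ _ a c hyz
  · have := h.A1 _ _ a; have := h.A1 _ _ b; have := h.A1 _ _ c; omega
  · exact key _ _ _ a c hyz
  · exact key _ _ _ b c hxy.symm
  · exact key _ _ _ a b hxz
  · exact key _ _ _ a b hxz
  · have := h.A1 _ _ a; have := h.A1 _ _ b; have := h.A1 _ _ c; omega
  · exact key _ _ _ b c hxy.symm

end BRel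

/-- enumeration of a hole from a given vertex -/
theorem hole_enum {U : Type} {S : SimpleGraph U} {v : U} (c : S.Walk v v) (hc : IsHole S c)
    {z : U} (hz : z ∈ c.support) :
    ∃ (n : ℕ) (g : ℕ → U), 4 ≤ n ∧ g 0 = z ∧ g n = z ∧ (∀ k < n, S.Adj (g k) (g (k+1))) ∧
      (∀ x, x ∈ c.support ↔ ∃ k < n, g k = x) ∧
      (∀ k, 2 ≤ k → k ≤ n - 2 → ¬ S.Adj z (g k)) ∧ g 1 ≠ g (n-1) := by
  classical
  obtain ⟨⟨hcyc, hch⟩, hl⟩ := hc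
  have hcyc' := hcyc.rotate hz
  refine ⟨c.length, (c.rotate z hz).getVert, hl, by simp, ?_, ?_, ?_, ?_, ?_⟩
  · have := (c.rotate z hz).getVert_length
    simpa using this
  · intro k hk
    exact (c.rotate z hz).adj_getVert_succ (by simpa using hk)
  · intro x
    rw [← Walk.mem_support_rotate_iff c z hz, Walk.mem_support_iff_exists_getVert]
    constructor
    · rintro ⟨n, hn, hle⟩
      rw [Walk.length_rotate] at hle
      rcases Nat.lt_or_eq_of_le hle with h | h
      · exact ⟨n, h, hn⟩
      · refine ⟨0, by omega, ?_⟩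
        rw [← hn, h]
        have := (c.rotate z hz).getVert_length
        rw [Walk.length_rotate] at this
        rw [this]; simp
    · rintro ⟨k, hk, rfl⟩
      exact ⟨k, rfl, by simpa using hk.le⟩
  · intro k h2 hk hadj
    have hmem : s(z, (c.rotate z hz).getVert k) ∈ (c.rotate z hz).edges := by
      rw [(Walk.rotate_edges c z hz).perm.mem_iff]
      refine hch _ _ hz ?_ hadj
      rw [← Walk.mem_support_rotate_iff c z hz]
      exact Walk.getVert_mem_support _ _
    rw [Walk.mk_mem_edges_iff_exists] at hmem
    obtain ⟨i, hi, he⟩ := hmem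
    rw [Walk.length_rotate] at hi
    have inj1 := hcyc'.getVert_injOn
    have inj2 := hcyc'.getVert_injOn'
    simp only [Walk.length_rotate] at inj1 inj2
    have h0 : (c.rotate z hz).getVert 0 = z := by simp
    have hn : (c.rotate z hz).getVert c.length = z := by
      have := (c.rotate z hz).getVert_length
      simpa using this
    rcases Sym2.eq_iff.1 he with ⟨e1, e2⟩ | ⟨e1, e2⟩
    · have : i = 0 := inj2 (by simp; omega) (by simp) (e1.trans h0.symm)
      subst this
      have : 0 + 1 = k := inj1 (by simp; omega) (by simp; omega) e2
      omega
    · have a1 : i = k := inj2 (by simp; omega) (by simp; omega) e1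
      subst a1
      have : i + 1 = c.length := inj1 (by simp; omega) (by simp; omega) (e2.trans hn.symm)
      omega
  · have := hcyc'.snd_ne_penultimate
    simpa [Walk.snd, Walk.penultimate] using this

theorem holeL {U : Type} {S : SimpleGraph U} {arc lt : U → U → Prop} {rk : U → ℕ}
    (h : BRel S arc lt rk) {v : U} (c : S.Walk v v) (hc : IsHole S c)
    {z u : U} (hz : z ∈ c.support) (hu : u ∈ c.support) (hl : lt u z) :
    ∀ w ∈ c.support, w = z ∨ arc w z ∨ lt w z := by
  obtain ⟨n, g, hn, g0, gn, hadj, hsupp, hnon, -⟩ := hole_enum c hc hz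
  obtain ⟨k, hk, rfl⟩ := (hsupp u).1 hu
  -- all middle vertices are below
  have hk1 : 2 ≤ k ∧ k ≤ n - 2 := by
    have a0 : k ≠ 0 := by rintro rfl; rw [g0] at hl; exact h.lt_irrefl _ hl
    have a1 : k ≠ 1 := by
      rintro rfl; exact h.not_adj hl (g0 ▸ (hadj 0 (by omega)).symm)
    have a2 : k ≠ n - 1 := by
      rintro rfl
      have := hadj (n-1) (by omega)
      rw [show n - 1 + 1 = n by omega, gn] at this
      exact h.not_adj hl this
    omega
  have na : ∀ j, 2 ≤ j → j ≤ n - 2 → ¬ arc (g j) z := fun j h1 h2 ha =>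
    hnon j h1 h2 ((h.adj_iff _ _).2 (Or.inr ha))
  have up : ∀ d, k + d ≤ n - 2 → lt (g (k+d)) z := by
    intro d
    induction d with
    | zero => intro _; exact hl
    | succ d ih =>
      intro hd
      exact h.spread (ih (by omega)) (hadj (k+d) (by omega)) (na _ (by omega) (by omega))
  have down : ∀ d, d + 2 ≤ k → lt (g (k-d)) z := by
    intro d
    induction d with
    | zero => intro _; exact hl
    | succ d ih =>
      intro hd
      have e := hadj (k-(d+1)) (by omega)
      rw [show k-(d+1)+1 = k-d by omega] at e
      exact h.spread (ih (by omega)) e.symm (na _ (by omega) (by omega))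
  have mid : ∀ j, 2 ≤ j → j ≤ n - 2 → lt (g j) z := by
    intro j h1 h2
    rcases le_total k j with hh | hh
    · have := up (j-k) (by omega)
      rwa [show k + (j-k) = j by omega] at this
    · have := down (k-j) (by omega)
      rwa [show k - (k-j) = j by omega] at this
  intro w hw
  obtain ⟨j, hj, rfl⟩ := (hsupp w).1 hw
  by_cases j0 : j = 0
  · left; rw [j0, g0]
  by_cases ja : arc (g j) z
  · exact Or.inr (Or.inl ja)
  right; right
  by_cases j1 : j = 1
  · subst j1
    exact h.spread (mid 2 le_rfl (by omega)) (hadj 1 (by omega)).symm ja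
  by_cases j2 : j = n - 1
  · subst j2
    have e := hadj (n-2) (by omega)
    rw [show n-2+1 = n-1 by omega] at e
    exact h.spread (mid (n-2) (by omega) le_rfl) e ja
  exact mid j (by omega) (by omega)

theorem holeTop {U : Type} {S : SimpleGraph U} {arc lt : U → U → Prop} {rk : U → ℕ}
    (h : BRel S arc lt rk) {v : U} (c : S.Walk v v) (hc : IsHole S c) :
    ∃ p ∈ c.support, ∃ y ∈ c.support, lt y p := by
  classical
  obtain ⟨q, hq, hmax⟩ := (c.support.toFinset).exists_max_image rk ⟨v, by simp⟩
  simp only [List.mem_toFinset] at hq hmax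
  obtain ⟨n, g, hn, g0, gn, hadj, hsupp, -, hne⟩ := hole_enum c hc hq
  have m1 : g 1 ∈ c.support := (hsupp _).2 ⟨1, by omega, rfl⟩
  have m2 : g (n-1) ∈ c.support := (hsupp _).2 ⟨n-1, by omega, rfl⟩
  have out : ∀ x ∈ c.support, S.Adj q x → arc q x := by
    intro x hx ha
    rcases (h.adj_iff _ _).1 ha with h1 | h1
    · exact h1
    · have := h.A1 _ _ h1; have := hmax x hx; omega
  have e1 : S.Adj q (g 1) := by have := hadj 0 (by omega); rwa [g0] at this
  have e2 : S.Adj q (g (n-1)) := by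
    have := hadj (n-1) (by omega)
    rw [show n-1+1 = n by omega, gn] at this
    exact this.symm
  rcases h.A2 _ _ _ (out _ m1 e1) (out _ m2 e2) hne with h1 | h1
  · exact ⟨_, m2, _, m1, h1⟩
  · exact ⟨_, m1, _, m2, h1⟩

structure BSys where
  X : Type
  I : Type
  finX : Finite X
  finI : Finite I
  arc : X → X → Prop
  lt : X → X → Prop
  mem : I → X → Prop
  rk : X → ℕ
  n : ℕ
  rk_lt : ∀ x, rk x < n
  A1 : ∀ u v, arc u v → rk v < rk u
  A2 : ∀ w u v, arc w u → arc w v → u ≠ v → lt u v ∨ lt v u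
  A3 : ∀ u v w, lt u v → arc u w → lt w v
  A4 : ∀ u v w, lt u v → arc w u → lt w v ∨ arc w v
  A5 : ∀ x y, arc x y → ¬ lt y x
  A6 : ∀ x y, lt x y → ¬ lt y x
  chain : ∀ i u v, mem i u → mem i v → u ≠ v → lt u v ∨ lt v u
  upc : ∀ i u v, mem i u → lt u v → mem i v

namespace BSys

def graph (B : BSys) : SimpleGraph B.X where
  Adj u v := B.arc u v ∨ B.arc v u
  symm := ⟨fun _ _ h => h.symm⟩
  loopless := ⟨fun x h => by
    have h' : B.arc x x := h.elim id id
    exact Nat.lt_irrefl _ (B.A1 _ _ h')⟩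

theorem brel (B : BSys) : BRel B.graph B.arc B.lt B.rk where
  adj_iff _ _ := Iff.rfl
  A1 := B.A1
  A2 := B.A2
  A3 := B.A3
  A4 := B.A4
  A5 := B.A5
  A6 := B.A6

def Good (B : BSys) (k : ℕ) : Prop :=
  ∀ C : B.X → ℕ, (∀ u v, B.arc u v → C u ≠ C v) →
    ∃ (i : B.I) (F : Finset ℕ), k ≤ F.card ∧ ∀ c ∈ F, ∃ x, B.mem i x ∧ C x = c

def zero : BSys where
  X := Unit
  I := Unit
  finX := inferInstance
  finI := inferInstance
  arc _ _ := False
  lt _ _ := False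
  mem _ _ := True
  rk _ := 0
  n := 1
  rk_lt _ := by simp
  A1 _ _ h := h.elim
  A2 _ _ _ h := h.elim
  A3 _ _ _ h := h.elim
  A4 _ _ _ h := h.elim
  A5 _ _ h := h.elim
  A6 _ _ h := h.elim
  chain _ u v _ _ h := (h rfl).elim
  upc _ _ _ _ h := h.elim

inductive SX (X I : Type) : Type
  | base (x : X) : SX X I
  | copy (s : I) (x : X) : SX X I
  | new (s r : I) : SX X I

def sArc (B : BSys) : SX B.X B.I → SX B.X B.I → Prop
  | .base x, .base y => B.arc x y
  | .copy s x, .copy t y => s = t ∧ B.arc x y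
  | .new s r, .copy t x => s = t ∧ B.mem r x
  | _, _ => False

def sLt (B : BSys) : SX B.X B.I → SX B.X B.I → Prop
  | .base x, .base y => B.lt x y
  | .copy s x, .copy t y => s = t ∧ B.lt x y
  | .copy s _, .base y => B.mem s y
  | .new s _, .base y => B.mem s y
  | _, _ => False

def sMem (B : BSys) : B.I × B.I × Bool → SX B.X B.I → Prop
  | (s, _, _), .base x => B.mem s x
  | (s, r, true), .copy t x => s = t ∧ B.mem r x
  | (s, r, false), .new s' r' => s = s' ∧ r = r'
  | _, _ => False

def sRk (B : BSys) : SX B.X B.I → ℕ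
  | .base x => B.rk x
  | .copy _ x => B.rk x
  | .new _ _ => B.n

def step (B : BSys) : BSys where
  X := SX B.X B.I
  I := B.I × B.I × Bool
  finX := by
    have := B.finX
    have := B.finI
    refine Finite.of_surjective (α := B.X ⊕ (B.I × B.X) ⊕ (B.I × B.I))
      (fun z => match z with
        | .inl x => SX.base x
        | .inr (.inl (s, x)) => SX.copy s x
        | .inr (.inr (s, r)) => SX.new s r) ?_
    intro z
    cases z with
    | base x => exact ⟨.inl x, rfl⟩
    | copy s x => exact ⟨.inr (.inl (s, x)), rfl⟩
    | new s r => exact ⟨.inr (.inr (s, r)), rfl⟩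
  finI := by
    have := B.finI
    infer_instance
  arc := B.sArc
  lt := B.sLt
  mem := B.sMem
  rk := B.sRk
  n := B.n + 1
  rk_lt x := by
    cases x <;> simp only [sRk]
    · have := B.rk_lt; grind
    · have := B.rk_lt; grind
    · omega
  A1 u v := by
    cases u <;> cases v <;> simp only [sArc, sRk] <;> have := B.A1 <;> have := B.rk_lt <;> grind
  A2 w u v := by
    cases w <;> cases u <;> cases v <;> simp only [sArc, sLt] <;> have := B.A2 <;>
      have := B.chain <;> grind
  A3 u v w := by
    cases w <;> cases u <;> cases v <;> simp only [sArc, sLt] <;> have := B.A3 <;> grind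
  A4 u v w := by
    cases w <;> cases u <;> cases v <;> simp only [sArc, sLt] <;> have := B.A4 <;>
      have := B.upc <;> grind
  A5 u v := by
    cases u <;> cases v <;> simp only [sArc, sLt] <;> have := B.A5 <;> grind
  A6 u v := by
    cases u <;> cases v <;> simp only [sLt] <;> have := B.A6 <;> grind
  chain i u v := by
    obtain ⟨s, r, b⟩ := i
    cases u <;> cases v <;> cases b <;> simp only [sMem, sLt] <;> have := B.chain <;> grind
  upc i u v := by
    obtain ⟨s, r, b⟩ := i
    cases u <;> cases v <;> cases b <;> simp only [sMem, sLt] <;> have := B.upc <;> grind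

theorem good_step (B : BSys) (k : ℕ) (h : B.Good k) : B.step.Good (k+1) := by
  classical
  intro C hC
  have hC' : ∀ u v : SX B.X B.I, B.sArc u v → C u ≠ C v := hC
  obtain ⟨s, F, hF, hFs⟩ := h (fun x => C (SX.base x)) (fun u v ha => hC' (.base u) (.base v) ha)
  obtain ⟨r, F', hF', hFr⟩ := h (fun x => C (SX.copy s x))
    (fun u v ha => hC' (.copy s u) (.copy s v) ⟨rfl, ha⟩)
  by_cases hsub : F' ⊆ F
  · by_cases hcard : k + 1 ≤ F.card
    · refine ⟨(s, r, true), F, hcard, fun c hc => ?_⟩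
      obtain ⟨x, hx, e⟩ := hFs c hc
      exact ⟨SX.base x, hx, e⟩
    · have heq : F' = F := Finset.eq_of_subset_of_card_le hsub (by omega)
      have hnew : C (SX.new s r) ∉ F := by
        rw [← heq]
        intro hm
        obtain ⟨x, hx, e⟩ := hFr _ hm
        exact hC' (.new s r) (.copy s x) ⟨rfl, hx⟩ e.symm
      refine ⟨(s, r, false), insert (C (SX.new s r)) F, ?_, fun c hc => ?_⟩
      · rw [Finset.card_insert_of_notMem hnew]; omega
      · rcases Finset.mem_insert.1 hc with rfl | hc
        · exact ⟨SX.new s r, ⟨rfl, rfl⟩, rfl⟩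
        · obtain ⟨x, hx, e⟩ := hFs c hc
          exact ⟨SX.base x, hx, e⟩
  · obtain ⟨c0, h1, h2⟩ := Finset.not_subset.1 hsub
    refine ⟨(s, r, true), insert c0 F, ?_, fun c hc => ?_⟩
    · rw [Finset.card_insert_of_notMem h2]; omega
    · rcases Finset.mem_insert.1 hc with rfl | hc
      · obtain ⟨x, hx, e⟩ := hFr _ h1
        exact ⟨SX.copy s x, ⟨rfl, hx⟩, e⟩
      · obtain ⟨x, hx, e⟩ := hFs c hc
        exact ⟨SX.base x, hx, e⟩

theorem exists_good (k : ℕ) : ∃ B : BSys, B.Good k := by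
  induction k with
  | zero => exact ⟨zero, fun C _ => ⟨(), ∅, by simp, by simp⟩⟩
  | succ k ih =>
    obtain ⟨B, hB⟩ := ih
    exact ⟨B.step, good_step B k hB⟩

theorem not_colorable (B : BSys) (k : ℕ) (h : B.Good (k+1)) : ¬ B.graph.Colorable k := by
  rintro ⟨C⟩
  obtain ⟨i, F, hF, hx⟩ := h (fun x => (C x : ℕ)) (fun u v ha e =>
    C.valid (show B.graph.Adj u v from Or.inl ha) (Fin.ext e))
  have : F ⊆ Finset.range k := by
    intro c hc
    obtain ⟨x, -, rfl⟩ := hx c hc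
    simp
  have := Finset.card_le_card this
  simp at this
  omega

theorem cliqueNumber_le (B : BSys) : cliqueNumber B.graph ≤ 2 := by
  classical
  unfold cliqueNumber
  refine csSup_le' ?_
  rintro n ⟨s, hs⟩
  by_contra hn
  have h3 : 3 ≤ s.card := by rw [hs.card_eq]; omega
  obtain ⟨a, b, c, ha, hb, hc, hab, hac, hbc⟩ := Finset.two_lt_card_iff.1 h3
  exact B.brel.no_triangle (hs.isClique ha hb hab) (hs.isClique hb hc hbc) (hs.isClique ha hc hac)

end BSys

theorem final_of {VH : Type} (H : SimpleGraph VH) (h : ∀ B : BSys, InForbs H B.graph) :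
    ¬ WeaklyPervasive H := by
  rintro ⟨f, hf⟩
  obtain ⟨B, hB⟩ := BSys.exists_good (f 0 + f 1 + f 2 + 1)
  have := B.finX
  have h1 := hf B.X (Fintype.ofFinite _) B.graph (h B)
  have h2 := B.cliqueNumber_le
  rw [chromaticNumber_le_iff_colorable] at h1
  refine B.not_colorable _ hB (h1.mono ?_)
  interval_cases cliqueNumber B.graph <;> omega

structure NRing {U : Type} (S : SimpleGraph U) (m : ℕ) where
  a : ZMod m → U
  b : ZMod m → U
  side : Bool → ∀ i, S.Walk (a i) (b i)
  conn : ∀ i, S.Walk (b i) (a (i + 1))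
  side_path : ∀ s i, (side s i).IsPath
  conn_path : ∀ i, (conn i).IsPath
  ab_ne : ∀ i, a i ≠ b i
  ab_nonadj : ∀ i, ¬ S.Adj (a i) (b i)
  side_inter : ∀ i x, x ∈ (side true i).support → x ∈ (side false i).support → x = a i ∨ x = b i
  bead_inter : ∀ s t i j, i ≠ j → ∀ x, x ∈ (side s i).support → x ∈ (side t j).support →
    (j = i + 1 ∧ x = b i ∧ x = a j) ∨ (i = j + 1 ∧ x = b j ∧ x = a i)
  conn_side : ∀ i s j x, x ∈ (conn i).support → x ∈ (side s j).support →
    (j = i ∧ x = b i) ∨ (j = i + 1 ∧ x = a (i + 1))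
  conn_conn : ∀ i j, i ≠ j → ∀ x, x ∈ (conn i).support → x ∈ (conn j).support → False
  adj : ∀ x y, ((∃ s i, x ∈ (side s i).support) ∨ ∃ i, x ∈ (conn i).support) →
    ((∃ s i, y ∈ (side s i).support) ∨ ∃ i, y ∈ (conn i).support) → S.Adj x y →
    (∃ s i, s(x, y) ∈ (side s i).edges) ∨ ∃ i, s(x, y) ∈ (conn i).edges

theorem zmod_ne {m : ℕ} (hm : 4 ≤ m) :
    (1 : ZMod m) ≠ 0 ∧ (2 : ZMod m) ≠ 0 ∧ (3 : ZMod m) ≠ 0 := by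
  have h : ∀ k : ℕ, 0 < k → k < 4 → ((k : ℕ) : ZMod m) ≠ 0 := by
    intro k h0 h1 h
    rw [ZMod.natCast_eq_zero_iff] at h
    have := Nat.le_of_dvd h0 h
    omega
  refine ⟨by simpa using h 1 (by omega) (by omega), by simpa using h 2 (by omega) (by omega),
    by simpa using h 3 (by omega) (by omega)⟩

theorem walk_mem_tail {U : Type} {S : SimpleGraph U} {u v x : U} (p : S.Walk u v)
    (h : x ∈ p.support) : x = u ∨ x ∈ p.support.tail := by
  rw [← p.cons_tail_support] at h
  exact List.mem_cons.1 h

theorem Necklace.toNRing {V : Type} {G : SimpleGraph V} {m : ℕ} (N : Necklace G m) (hm : 4 ≤ m) :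
    ∃ R : NRing G m, ∀ x y, G.Adj x y →
      (∃ s i, s(x, y) ∈ (R.side s i).edges) ∨ ∃ i, s(x, y) ∈ (R.conn i).edges := by
  classical
  obtain ⟨n1, n2, n3⟩ := zmod_ne hm
  let side : Bool → ∀ i, G.Walk (N.a i) (N.b i) := fun s i =>
    match s with
    | true => (N.B i).takeUntil (N.b i) (N.b_mem i)
    | false => ((N.B i).dropUntil (N.b i) (N.b_mem i)).reverse
  have hsub : ∀ s i x, x ∈ (side s i).support → x ∈ (N.B i).support := by
    intro s i x hx
    cases s
    · simp only [side, Walk.support_reverse, List.mem_reverse] at hx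
      exact Walk.support_dropUntil_subset_support _ _ hx
    · exact Walk.support_takeUntil_subset_support _ _ hx
  have aB : ∀ i, N.a i ∈ (N.B i).support := fun i => Walk.start_mem_support _
  have hedge : ∀ x y, G.Adj x y →
      (∃ s i, s(x, y) ∈ (side s i).edges) ∨ ∃ i, s(x, y) ∈ (N.P i).edges := by
    intro x y h
    rcases N.cover_edge x y h with ⟨i, hi⟩ | h
    · left
      rw [← (N.B i).take_spec (N.b_mem i), Walk.edges_append, List.mem_append] at hi
      rcases hi with hi | hi
      · exact ⟨true, i, hi⟩
      · exact ⟨false, i, by simpa [side] using hi⟩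
    · exact Or.inr h
  refine ⟨⟨N.a, N.b, side, N.P, ?_, N.P_path, N.ab_ne, N.ab_nonadj, ?_, ?_, ?_, ?_, ?_⟩, hedge⟩
  · intro s i
    cases s
    · simp only [side]
      rw [Walk.isPath_reverse_iff]
      have h := N.B_cycle i
      rw [← (N.B i).take_spec (N.b_mem i)] at h
      exact h.isPath_of_append_right (Walk.not_nil_of_ne (N.ab_ne i))
    · exact (N.B_cycle i).isPath_takeUntil _
  · intro i x h1 h2
    simp only [side, Walk.support_reverse, List.mem_reverse] at h1 h2
    have h := (N.B_cycle i).support_nodup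
    rw [← (N.B i).take_spec (N.b_mem i), Walk.tail_support_append, List.nodup_append'] at h
    rcases walk_mem_tail _ h1 with e | e
    · exact Or.inl e
    rcases walk_mem_tail _ h2 with e' | e'
    · exact Or.inr e'
    exact (h.2.2 e e').elim
  · intro s t i j hij x h1 h2
    exact N.bead_disjoint i j hij x (hsub _ _ _ h1) (hsub _ _ _ h2)
  · intro i s j x h1 h2
    have h2' := hsub _ _ _ h2
    rcases N.path_bead_disjoint i j x h1 h2' with e | e
    · by_cases hij : j = i
      · exact Or.inl ⟨hij, e⟩
      · rcases N.bead_disjoint i j (Ne.symm hij) x (e ▸ N.b_mem i) h2' with ⟨e1, e2, e3⟩ | ⟨e1, e2, e3⟩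
        · right; subst e1; exact ⟨rfl, e3⟩
        · exact (N.ab_ne i (e3.symm.trans e)).elim
    · by_cases hij : j = i + 1
      · exact Or.inr ⟨hij, e⟩
      · rcases N.bead_disjoint (i+1) j (Ne.symm hij) x (e ▸ aB (i+1)) h2' with ⟨e1, e2, e3⟩ | ⟨e1, e2, e3⟩
        · exact (N.ab_ne (i+1) (e.symm.trans e2)).elim
        · left
          have : j = i := (add_right_cancel e1).symm
          subst this; exact ⟨rfl, e2⟩
  · intro i j hij x h1 h2
    obtain ⟨h3, h4⟩ := N.path_disjoint i j hij x h1 h2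
    have key : ∀ i j, i ≠ j → x = N.b i → x = N.a (j+1) → False := by
      intro i j hij e1 e2
      by_cases hh : i = j + 1
      · subst hh; exact N.ab_ne _ (e2.symm.trans e1)
      rcases N.bead_disjoint i (j+1) hh x (e1 ▸ N.b_mem i) (e2 ▸ aB (j+1)) with ⟨f1, f2, f3⟩ | ⟨f1, f2, f3⟩
      · exact hij (add_right_cancel f1).symm
      · exact N.ab_ne i (f3.symm.trans e1)
    rcases h3 with h3 | h3 <;> rcases h4 with h4 | h4
    · rcases N.bead_disjoint i j hij x (h3 ▸ N.b_mem i) (h4 ▸ N.b_mem j) with ⟨f1, f2, f3⟩ | ⟨f1, f2, f3⟩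
      · exact N.ab_ne j (f3.symm.trans h4)
      · exact N.ab_ne i (f3.symm.trans h3)
    · exact key i j hij h3 h4
    · exact key j i (Ne.symm hij) h4 h3
    · rcases N.bead_disjoint (i+1) (j+1) (fun e => hij (add_right_cancel e)) x (h3 ▸ aB (i+1))
        (h4 ▸ aB (j+1)) with ⟨f1, f2, f3⟩ | ⟨f1, f2, f3⟩
      · exact N.ab_ne _ (h3.symm.trans f2)
      · exact N.ab_ne _ (h4.symm.trans f2)
  · intro x y _ _ h
    exact hedge x y h

theorem exists_chordless {U : Type} {S : SimpleGraph U} (K : U → Prop) {u v : U} (p0 : S.Walk u v)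
    (h0 : ∀ w ∈ p0.support, K w) :
    ∃ p : S.Walk u v, p.IsPath ∧ (∀ w ∈ p.support, K w) ∧
      ∀ x y, x ∈ p.support → y ∈ p.support → S.Adj x y → s(x, y) ∈ p.edges := by
  classical
  have hex : ∃ n, ∃ p : S.Walk u v, (∀ w ∈ p.support, K w) ∧ p.length = n := ⟨_, p0, h0, rfl⟩
  obtain ⟨p, hpK, hpn⟩ := Nat.find_spec hex
  have hmin : ∀ q : S.Walk u v, (∀ w ∈ q.support, K w) → p.length ≤ q.length := by
    intro q hq
    rw [hpn]
    exact Nat.find_min' hex ⟨q, hq, rfl⟩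
  have hqK : ∀ w ∈ p.bypass.support, K w := fun w hw =>
    hpK w (Walk.support_bypass_subset_support _ hw)
  have hmin' : ∀ q : S.Walk u v, (∀ w ∈ q.support, K w) → p.bypass.length ≤ q.length :=
    fun q hq => (Walk.length_bypass_le_length p).trans (hmin q hq)
  refine ⟨p.bypass, p.bypass_isPath, hqK, ?_⟩
  generalize p.bypass = q at hqK hmin'
  have key : ∀ i j, i < j → j ≤ q.length → S.Adj (q.getVert i) (q.getVert j) →
      s(q.getVert i, q.getVert j) ∈ q.edges := by
    intro i j hij hj ha
    by_cases e : j = i + 1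
    · subst e
      exact (Walk.mk_mem_edges_iff_exists _).2 ⟨i, by omega, rfl⟩
    · exfalso
      have h1 := hmin' ((q.take i).append (Walk.cons ha (q.drop j))) (by
        intro w hw
        rw [Walk.mem_support_append_iff, Walk.support_cons, List.mem_cons] at hw
        rcases hw with hw | rfl | hw
        · exact hqK w ((q.isSubwalk_take i).support_subset hw)
        · exact hqK _ (Walk.getVert_mem_support _ _)
        · exact hqK w ((q.isSubwalk_drop j).support_subset hw))
      rw [Walk.length_append, Walk.length_cons, Walk.take_length, Walk.drop_length] at h1
      omega
  intro x y hx hy ha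
  obtain ⟨i, rfl, hi⟩ := Walk.mem_support_iff_exists_getVert.1 hx
  obtain ⟨j, rfl, hj⟩ := Walk.mem_support_iff_exists_getVert.1 hy
  rcases lt_trichotomy i j with h | h | h
  · exact key i j h hj ha
  · subst h; exact (ha.ne rfl).elim
  · rw [Sym2.eq_swap]; exact key j i h hi ha.symm

section Sub
variable {V W : Type} {G : SimpleGraph V} {S : SimpleGraph W} {f : V ↪ W}
  {P : ∀ ⦃u v : V⦄, G.Adj u v → S.Walk (f u) (f v)}

def KSet (P : ∀ ⦃u v : V⦄, G.Adj u v → S.Walk (f u) (f v)) {u v : V} (σ : G.Walk u v) (w : W) :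
    Prop :=
  w = f u ∨ ∃ (x y : V) (h : G.Adj x y), s(x, y) ∈ σ.edges ∧ w ∈ (P h).support

theorem exists_KSet_walk {u v : V} (σ : G.Walk u v) :
    ∃ p : S.Walk (f u) (f v), ∀ w ∈ p.support, KSet P σ w := by
  induction σ with
  | nil => exact ⟨Walk.nil, fun w hw => Or.inl (by simpa using hw)⟩
  | @cons u u' v h σ ih =>
    obtain ⟨p, hp⟩ := ih
    refine ⟨(P h).append p, fun w hw => Or.inr ?_⟩
    rcases (Walk.mem_support_append_iff _ _).1 hw with hw | hw
    · exact ⟨u, u', h, by simp, hw⟩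
    · rcases hp w hw with rfl | ⟨x, y, h', h1, h2⟩
      · exact ⟨u, u', h, by simp, by simp⟩
      · exact ⟨x, y, h', by simp [h1], h2⟩

theorem exists_hat (P : ∀ ⦃u v : V⦄, G.Adj u v → S.Walk (f u) (f v)) {u v : V} (σ : G.Walk u v) :
    ∃ p : S.Walk (f u) (f v), p.IsPath ∧ (∀ w ∈ p.support, KSet P σ w) ∧
      ∀ x y, x ∈ p.support → y ∈ p.support → S.Adj x y → s(x, y) ∈ p.edges := by
  obtain ⟨p, hp⟩ := exists_KSet_walk (P := P) σ
  exact exists_chordless _ p hp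

theorem kset_f (hS : IsSubdivisionVia S G f P) {u v : V} {σ : G.Walk u v} {x : V}
    (h : KSet P σ (f x)) : x ∈ σ.support := by
  rcases h with h | ⟨y, z, h, h1, h2⟩
  · rw [f.injective h]; simp
  · rcases hS.2.1 h x h2 with rfl | rfl
    · exact Walk.fst_mem_support_of_mem_edges _ h1
    · exact Walk.snd_mem_support_of_mem_edges _ h1

theorem kset_inter (hS : IsSubdivisionVia S G f P) {u v u' v' : V} {σ : G.Walk u v}
    {τ : G.Walk u' v'}
    (hn : ∀ x y, x ∈ σ.support → x ∈ τ.support → y ∈ σ.support → y ∈ τ.support → ¬ G.Adj x y)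
    {w : W} (h1 : KSet P σ w) (h2 : KSet P τ w) :
    ∃ x, w = f x ∧ x ∈ σ.support ∧ x ∈ τ.support := by
  have key : ∃ x, w = f x := by
    rcases h1 with h1 | ⟨x, y, h, e, hw⟩
    · exact ⟨_, h1⟩
    rcases h2 with h2 | ⟨x', y', h', e', hw'⟩
    · exact ⟨_, h2⟩
    refine hS.2.2.1 h h' ?_ w hw hw'
    intro e2
    rw [← e2] at e'
    exact hn x y (Walk.fst_mem_support_of_mem_edges _ e) (Walk.fst_mem_support_of_mem_edges _ e')
      (Walk.snd_mem_support_of_mem_edges _ e) (Walk.snd_mem_support_of_mem_edges _ e') h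
  obtain ⟨x, rfl⟩ := key
  exact ⟨x, rfl, kset_f hS h1, kset_f hS h2⟩

theorem NRing.subdiv {m : ℕ} (hm : 4 ≤ m) (R : NRing G m)
    (hcov : ∀ x y, G.Adj x y →
      (∃ s i, s(x, y) ∈ (R.side s i).edges) ∨ ∃ i, s(x, y) ∈ (R.conn i).edges)
    (hS : IsSubdivisionVia S G f P) : Nonempty (NRing S m) := by
  classical
  obtain ⟨n1, n2, n3⟩ := zmod_ne hm
  choose sd sd1 sd2 sd3 using fun (s : Bool) (i : ZMod m) => exists_hat P (R.side s i)
  choose cn cn1 cn2 cn3 using fun (i : ZMod m) => exists_hat P (R.conn i)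
  have na : ∀ i x y, (x = R.a i ∨ x = R.b i) → (y = R.a i ∨ y = R.b i) → ¬ G.Adj x y := by
    rintro i x y (rfl | rfl) (rfl | rfl) h
    · exact h.ne rfl
    · exact R.ab_nonadj _ h
    · exact R.ab_nonadj _ h.symm
    · exact h.ne rfl
  -- intersections in G
  have i1 : ∀ s t i, s ≠ t → ∀ x, x ∈ (R.side s i).support → x ∈ (R.side t i).support →
      x = R.a i ∨ x = R.b i := by
    intro s t i hst x h1 h2
    cases s <;> cases t
    · exact (hst rfl).elim
    · exact R.side_inter i x h2 h1
    · exact R.side_inter i x h1 h2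
    · exact (hst rfl).elim
  have j1 : ∀ s t i, s ≠ t → ∀ w, KSet P (R.side s i) w → KSet P (R.side t i) w →
      w = f (R.a i) ∨ w = f (R.b i) := by
    intro s t i hst w h1 h2
    obtain ⟨x, rfl, h3, h4⟩ := kset_inter hS (fun x y a b c d =>
      na i x y (i1 s t i hst x a b) (i1 s t i hst y c d)) h1 h2
    rcases i1 s t i hst x h3 h4 with rfl | rfl
    · exact Or.inl rfl
    · exact Or.inr rfl
  have j2 : ∀ s t i j, i ≠ j → ∀ w, KSet P (R.side s i) w → KSet P (R.side t j) w →
      (j = i + 1 ∧ w = f (R.b i) ∧ w = f (R.a j)) ∨ (i = j + 1 ∧ w = f (R.b j) ∧ w = f (R.a i)) := by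
    intro s t i j hij w h1 h2
    obtain ⟨x, rfl, h3, h4⟩ := kset_inter hS (fun x y a b c d h => by
      rcases R.bead_inter s t i j hij x a b with ⟨e1, e2, e3⟩ | ⟨e1, e2, e3⟩ <;>
      rcases R.bead_inter s t i j hij y c d with ⟨e4, e5, e6⟩ | ⟨e4, e5, e6⟩
      · exact h.ne (e2.trans e5.symm)
      · apply n2; rw [e4] at e1; linear_combination -e1
      · apply n2; rw [e4] at e1; linear_combination -e1
      · exact h.ne (e2.trans e5.symm)) h1 h2
    rcases R.bead_inter s t i j hij x h3 h4 with ⟨e1, e2, e3⟩ | ⟨e1, e2, e3⟩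
    · exact Or.inl ⟨e1, congrArg f e2, congrArg f e3⟩
    · exact Or.inr ⟨e1, congrArg f e2, congrArg f e3⟩
  have j3 : ∀ i s j w, KSet P (R.conn i) w → KSet P (R.side s j) w →
      (j = i ∧ w = f (R.b i)) ∨ (j = i + 1 ∧ w = f (R.a (i+1))) := by
    intro i s j w h1 h2
    obtain ⟨x, rfl, h3, h4⟩ := kset_inter hS (fun x y a b c d h => by
      rcases R.conn_side i s j x a b with ⟨e1, e2⟩ | ⟨e1, e2⟩ <;>
      rcases R.conn_side i s j y c d with ⟨e4, e5⟩ | ⟨e4, e5⟩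
      · exact h.ne (e2.trans e5.symm)
      · apply n1; rw [e4] at e1; linear_combination e1
      · apply n1; rw [e4] at e1; linear_combination -e1
      · exact h.ne (e2.trans e5.symm)) h1 h2
    rcases R.conn_side i s j x h3 h4 with ⟨e1, e2⟩ | ⟨e1, e2⟩
    · exact Or.inl ⟨e1, congrArg f e2⟩
    · exact Or.inr ⟨e1, congrArg f e2⟩
  have j4 : ∀ i j, i ≠ j → ∀ w, KSet P (R.conn i) w → KSet P (R.conn j) w → False := by
    intro i j hij w h1 h2
    obtain ⟨x, rfl, h3, h4⟩ := kset_inter hS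
      (fun x y a b c d h => R.conn_conn i j hij x a b) h1 h2
    exact R.conn_conn i j hij x h3 h4
  refine ⟨⟨fun i => f (R.a i), fun i => f (R.b i), sd, cn, sd1, cn1, ?_, ?_, ?_, ?_, ?_, ?_, ?_⟩⟩
  · intro i e; exact R.ab_ne i (f.injective e)
  · intro i h
    obtain ⟨u, v, h', he⟩ := hS.2.2.2.2 h
    have e1 := hS.2.1 h' _ (Walk.fst_mem_support_of_mem_edges _ he)
    have e2 := hS.2.1 h' _ (Walk.snd_mem_support_of_mem_edges _ he)
    rcases e1 with e1 | e1 <;> rcases e2 with e2 | e2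
    · exact R.ab_ne i (e1.trans e2.symm)
    · subst e1; subst e2; exact R.ab_nonadj i h'
    · subst e1; subst e2; exact R.ab_nonadj i h'.symm
    · exact R.ab_ne i (e1.trans e2.symm)
  · intro i x h1 h2
    exact j1 true false i (by simp) x (sd2 _ _ _ h1) (sd2 _ _ _ h2)
  · intro s t i j hij x h1 h2
    exact j2 s t i j hij x (sd2 _ _ _ h1) (sd2 _ _ _ h2)
  · intro i s j x h1 h2
    exact j3 i s j x (cn2 _ _ h1) (sd2 _ _ _ h2)
  · intro i j hij x h1 h2
    exact j4 i j hij x (cn2 _ _ h1) (cn2 _ _ h2)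
  · intro x y hx hy h
    obtain ⟨u, v, h', he⟩ := hS.2.2.2.2 h
    have hxm := Walk.fst_mem_support_of_mem_edges _ he
    have hym := Walk.snd_mem_support_of_mem_edges _ he
    rcases hcov u v h' with ⟨s, i, hi⟩ | ⟨i, hi⟩
    · left
      have up : ∀ z, z ∈ (P h').support →
          ((∃ s i, z ∈ (sd s i).support) ∨ ∃ i, z ∈ (cn i).support) → z ∈ (sd s i).support := by
        intro z hz hm
        have kz : KSet P (R.side s i) z := Or.inr ⟨u, v, h', hi, hz⟩
        rcases hm with ⟨t, j, hj⟩ | ⟨j, hj⟩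
        · by_cases hij : i = j
          · subst hij
            by_cases hst : s = t
            · subst hst; exact hj
            · rcases j1 s t i hst z kz (sd2 _ _ _ hj) with rfl | rfl <;> simp
          · rcases j2 s t i j hij z kz (sd2 _ _ _ hj) with ⟨_, rfl, _⟩ | ⟨_, _, rfl⟩ <;> simp
        · rcases j3 j s i z (cn2 _ _ hj) kz with ⟨rfl, rfl⟩ | ⟨rfl, rfl⟩ <;> simp
      exact ⟨s, i, sd3 s i x y (up x hxm hx) (up y hym hy) h⟩
    · right
      have up : ∀ z, z ∈ (P h').support →
          ((∃ s i, z ∈ (sd s i).support) ∨ ∃ i, z ∈ (cn i).support) → z ∈ (cn i).support := by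
        intro z hz hm
        have kz : KSet P (R.conn i) z := Or.inr ⟨u, v, h', hi, hz⟩
        rcases hm with ⟨t, j, hj⟩ | ⟨j, hj⟩
        · rcases j3 i t j z kz (sd2 _ _ _ hj) with ⟨rfl, rfl⟩ | ⟨rfl, rfl⟩ <;> simp
        · by_cases hij : i = j
          · subst hij; exact hj
          · exact (j4 i j hij z kz (cn2 _ _ hj)).elim
      exact ⟨i, cn3 i x y (up x hxm hx) (up y hym hy) h⟩

end Sub

theorem isPath_append' {U : Type} {S : SimpleGraph U} {u v w : U} {p : S.Walk u v} {q : S.Walk v w}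
    (hp : p.IsPath) (hq : q.IsPath) (h : ∀ x, x ∈ p.support → x ∈ q.support → x = v) :
    (p.append q).IsPath := by
  rw [Walk.isPath_def] at *
  rw [Walk.support_append, List.nodup_append']
  have h2 := hq
  rw [← q.cons_tail_support, List.nodup_cons] at h2
  refine ⟨hp, h2.2, ?_⟩
  intro x h1 h3
  have := h x h1 (List.mem_of_mem_tail h3)
  subst this
  exact h2.1 h3

theorem not_mem_tail {U : Type} {S : SimpleGraph U} {u v : U} {p : S.Walk u v} (hp : p.IsPath) :
    u ∉ p.support.tail := by
  rw [Walk.isPath_def, ← p.cons_tail_support, List.nodup_cons] at hp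
  exact hp.1

namespace NRing
variable {U : Type} {S : SimpleGraph U} {m : ℕ}

theorem two_le_side (R : NRing S m) (s : Bool) (i : ZMod m) : 2 ≤ (R.side s i).length := by
  by_contra h
  have h0 : (R.side s i).length = 0 ∨ (R.side s i).length = 1 := by omega
  rcases h0 with h0 | h0
  · exact R.ab_ne i (Walk.eq_of_length_eq_zero h0)
  · exact R.ab_nonadj i (Walk.adj_of_length_eq_one h0)

theorem side_inter' (R : NRing S m) {s t : Bool} {i : ZMod m} (hst : s ≠ t) {x : U}
    (h1 : x ∈ (R.side s i).support) (h2 : x ∈ (R.side t i).support) : x = R.a i ∨ x = R.b i := by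
  cases s <;> cases t
  · exact (hst rfl).elim
  · exact R.side_inter i x h2 h1
  · exact R.side_inter i x h1 h2
  · exact (hst rfl).elim

theorem nonadj' (R : NRing S m) {i : ZMod m} {x y : U} (hx : x = R.a i ∨ x = R.b i)
    (hy : y = R.a i ∨ y = R.b i) : ¬ S.Adj x y := by
  rcases hx with rfl | rfl <;> rcases hy with rfl | rfl <;> intro h
  · exact h.ne rfl
  · exact R.ab_nonadj _ h
  · exact R.ab_nonadj _ h.symm
  · exact h.ne rfl

def Bead (R : NRing S m) (i : ZMod m) (x : U) : Prop := ∃ t, x ∈ (R.side t i).support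

def Blk (R : NRing S m) (s : ZMod m → Bool) (i : ZMod m) (x : U) : Prop :=
  x ∈ (R.side (s i) i).support ∨ x ∈ (R.conn i).support

def W0 (R : NRing S m) (x : U) : Prop :=
  (∃ s i, x ∈ (R.side s i).support) ∨ ∃ i, x ∈ (R.conn i).support

theorem bead_hole (R : NRing S m) (hm : 4 ≤ m) (i : ZMod m) :
    ∃ (v : U) (c : S.Walk v v), IsHole S c ∧ ∀ x, x ∈ c.support ↔ R.Bead i x := by
  obtain ⟨n1, n2, n3⟩ := zmod_ne hm
  have l1 := R.two_le_side true i
  have l2 := R.two_le_side false i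
  have hs : ∀ x, x ∈ ((R.side true i).append (R.side false i).reverse).support ↔ R.Bead i x := by
    intro x
    rw [Walk.mem_support_append_iff, Walk.support_reverse, List.mem_reverse, Bead]
    simp [or_comm]
  refine ⟨R.a i, (R.side true i).append (R.side false i).reverse, ⟨⟨?_, ?_⟩, ?_⟩, hs⟩
  · refine (R.side_path true i).isCycle_append (R.side_path false i).reverse ?_ (Or.inl (by omega))
    intro x h1 h2
    have h1' := List.mem_of_mem_tail h1
    have h2' := List.mem_of_mem_tail h2
    rw [Walk.support_reverse, List.mem_reverse] at h2'
    rcases R.side_inter i x h1' h2' with rfl | rfl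
    · exact not_mem_tail (R.side_path true i) h1
    · exact not_mem_tail (R.side_path false i).reverse h2
  · intro x y hx hy h
    rw [hs] at hx hy
    obtain ⟨t1, hx⟩ := hx
    obtain ⟨t2, hy⟩ := hy
    rw [Walk.edges_append, List.mem_append, Walk.edges_reverse, List.mem_reverse]
    rcases R.adj x y (Or.inl ⟨_, _, hx⟩) (Or.inl ⟨_, _, hy⟩) h with ⟨t, j, hj⟩ | ⟨j, hj⟩
    · by_cases hij : i = j
      · subst hij
        cases t
        · exact Or.inr hj
        · exact Or.inl hj
      · exfalso
        have hx' := Walk.fst_mem_support_of_mem_edges _ hj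
        have hy' := Walk.snd_mem_support_of_mem_edges _ hj
        rcases R.bead_inter t1 t i j hij x hx hx' with ⟨e1, e2, e3⟩ | ⟨e1, e2, e3⟩ <;>
        rcases R.bead_inter t2 t i j hij y hy hy' with ⟨e4, e5, e6⟩ | ⟨e4, e5, e6⟩
        · exact h.ne (e2.trans e5.symm)
        · apply n2; rw [e4] at e1; linear_combination -e1
        · apply n2; rw [e4] at e1; linear_combination -e1
        · exact h.ne (e2.trans e5.symm)
    · exfalso
      have hx' := Walk.fst_mem_support_of_mem_edges _ hj
      have hy' := Walk.snd_mem_support_of_mem_edges _ hj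
      rcases R.conn_side j t1 i x hx' hx with ⟨e1, e2⟩ | ⟨e1, e2⟩ <;>
      rcases R.conn_side j t2 i y hy' hy with ⟨e4, e5⟩ | ⟨e4, e5⟩
      · exact h.ne (e2.trans e5.symm)
      · apply n1; rw [e4] at e1; linear_combination e1
      · apply n1; rw [e4] at e1; linear_combination -e1
      · exact h.ne (e2.trans e5.symm)
  · rw [Walk.length_append, Walk.length_reverse]; omega

theorem blk_inter (R : NRing S m) (s : ZMod m → Bool) {i j : ZMod m} (hij : i ≠ j) {x : U}
    (h1 : R.Blk s i x) (h2 : R.Blk s j x) : (j = i + 1 ∧ x = R.a j) ∨ (i = j + 1 ∧ x = R.a i) := by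
  rcases h1 with h1 | h1 <;> rcases h2 with h2 | h2
  · rcases R.bead_inter _ _ i j hij x h1 h2 with ⟨e1, e2, e3⟩ | ⟨e1, e2, e3⟩
    · exact Or.inl ⟨e1, e3⟩
    · exact Or.inr ⟨e1, e3⟩
  · rcases R.conn_side _ _ _ x h2 h1 with ⟨e1, e2⟩ | ⟨e1, e2⟩
    · exact (hij e1).elim
    · exact Or.inr ⟨e1, e1 ▸ e2⟩
  · rcases R.conn_side _ _ _ x h1 h2 with ⟨e1, e2⟩ | ⟨e1, e2⟩
    · exact (hij e1.symm).elim
    · exact Or.inl ⟨e1, e1 ▸ e2⟩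
  · exact (R.conn_conn i j hij x h1 h2).elim

theorem blk_walk (R : NRing S m) (hm : 4 ≤ m) (s : ZMod m → Bool) (i j : ZMod m) (hj : j = i + 1) :
    ∃ q : S.Walk (R.a i) (R.a j), q.IsPath ∧ (∀ x, x ∈ q.support ↔ R.Blk s i x) ∧
      (∀ e, e ∈ (R.side (s i) i).edges → e ∈ q.edges) ∧ (∀ e, e ∈ (R.conn i).edges → e ∈ q.edges) ∧
      2 ≤ q.length := by
  obtain ⟨n1, n2, n3⟩ := zmod_ne hm
  subst hj
  refine ⟨(R.side (s i) i).append (R.conn i), ?_, ?_, ?_, ?_, ?_⟩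
  · refine isPath_append' (R.side_path _ _) (R.conn_path _) ?_
    intro x h1 h2
    rcases R.conn_side _ _ _ x h2 h1 with ⟨e1, e2⟩ | ⟨e1, e2⟩
    · exact e2
    · exact (n1 (by linear_combination -e1)).elim
  · intro x; rw [Walk.mem_support_append_iff, Blk]
  · intro e h; rw [Walk.edges_append, List.mem_append]; exact Or.inl h
  · intro e h; rw [Walk.edges_append, List.mem_append]; exact Or.inr h
  · have := R.two_le_side (s i) i
    rw [Walk.length_append]; omega

theorem cast_succ_ne {m : ℕ} {j k : ℕ} (hjk : j < k) (hk : k + 1 < m) :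
    ((j : ℕ) : ZMod m) ≠ (k : ZMod m) + 1 := by
  intro h
  have h' : ((j : ℕ) : ZMod m) = ((k + 1 : ℕ) : ZMod m) := by push_cast; exact h
  rw [ZMod.natCast_eq_natCast_iff'] at h'
  rw [Nat.mod_eq_of_lt (by omega), Nat.mod_eq_of_lt hk] at h'
  omega

theorem cast_ne {m : ℕ} {j k : ℕ} (hjk : j < k) (hk : k < m) :
    ((j : ℕ) : ZMod m) ≠ (k : ZMod m) := by
  intro h'
  rw [ZMod.natCast_eq_natCast_iff'] at h'
  rw [Nat.mod_eq_of_lt (by omega), Nat.mod_eq_of_lt hk] at h'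
  omega

theorem long_walk (R : NRing S m) (hm : 4 ≤ m) (s : ZMod m → Bool) (k : ℕ) (h1 : 1 ≤ k)
    (hk : k < m) :
    ∃ q : S.Walk (R.a 0) (R.a (k : ZMod m)), q.IsPath ∧
      (∀ x, x ∈ q.support ↔ ∃ j : ℕ, j < k ∧ R.Blk s (j : ZMod m) x) ∧
      (∀ j : ℕ, j < k → ∀ e, e ∈ (R.side (s j) j).edges → e ∈ q.edges) ∧
      (∀ j : ℕ, j < k → ∀ e, e ∈ (R.conn j).edges → e ∈ q.edges) ∧
      2 ≤ q.length := by
  induction k, h1 using Nat.le_induction with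
  | base =>
    obtain ⟨q, q1, q2, q3, q4, q5⟩ := R.blk_walk hm s 0 ((1 : ℕ) : ZMod m) (by simp)
    refine ⟨q, q1, ?_, ?_, ?_, q5⟩
    · intro x
      rw [q2]
      constructor
      · intro h; exact ⟨0, by omega, by simpa using h⟩
      · rintro ⟨j, hj, h⟩
        obtain rfl : j = 0 := by omega
        simpa using h
    · intro j hj
      obtain rfl : j = 0 := by omega
      rw [Nat.cast_zero]
      exact q3
    · intro j hj
      obtain rfl : j = 0 := by omega
      rw [Nat.cast_zero]
      exact q4
  | succ k h1 ih =>
    obtain ⟨p, p1, p2, p3, p4, p5⟩ := ih (by omega)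
    obtain ⟨q, q1, q2, q3, q4, q5⟩ := R.blk_walk hm s (k : ZMod m) ((k+1 : ℕ) : ZMod m) (by simp)
    refine ⟨p.append q, isPath_append' p1 q1 ?_, ?_, ?_, ?_, ?_⟩
    · intro x hx hy
      rw [p2] at hx
      rw [q2] at hy
      obtain ⟨j, hj, hx⟩ := hx
      rcases R.blk_inter s (cast_ne hj (by omega)) hx hy with ⟨e1, e2⟩ | ⟨e1, e2⟩
      · exact e2
      · exact (cast_succ_ne hj hk e1).elim
    · intro x
      rw [Walk.mem_support_append_iff, p2, q2]
      constructor
      · rintro (⟨j, hj, h⟩ | h)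
        · exact ⟨j, by omega, h⟩
        · exact ⟨k, by omega, h⟩
      · rintro ⟨j, hj, h⟩
        rcases Nat.lt_succ_iff_lt_or_eq.1 hj with hj | rfl
        · exact Or.inl ⟨j, hj, h⟩
        · exact Or.inr h
    · intro j hj e he
      rw [Walk.edges_append, List.mem_append]
      rcases Nat.lt_succ_iff_lt_or_eq.1 hj with hj | rfl
      · exact Or.inl (p3 j hj e he)
      · exact Or.inr (q3 e he)
    · intro j hj e he
      rw [Walk.edges_append, List.mem_append]
      rcases Nat.lt_succ_iff_lt_or_eq.1 hj with hj | rfl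
      · exact Or.inl (p4 j hj e he)
      · exact Or.inr (q4 e he)
    · rw [Walk.length_append]; omega

theorem global_hole (R : NRing S m) (hm : 4 ≤ m) (s : ZMod m → Bool) :
    ∃ (v : U) (c : S.Walk v v), IsHole S c ∧ ∀ x, x ∈ c.support ↔ ∃ i, R.Blk s i x := by
  have : NeZero m := ⟨by omega⟩
  obtain ⟨k, rfl⟩ : ∃ k, m = k + 1 := ⟨m - 1, by omega⟩
  obtain ⟨p, p1, p2, p3, p4, p5⟩ := R.long_walk hm s k (by omega) (by omega)
  have hk0 : (0 : ZMod (k+1)) = (k : ZMod (k+1)) + 1 := by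
    have := ZMod.natCast_self (k+1)
    rw [Nat.cast_add, Nat.cast_one] at this
    exact this.symm
  obtain ⟨q, q1, q2, q3, q4, q5⟩ := R.blk_walk hm s (k : ZMod (k+1)) 0 hk0
  have hcast : ∀ i : ZMod (k+1), ∃ j : ℕ, j < k + 1 ∧ (j : ZMod (k+1)) = i := fun i =>
    ⟨i.val, ZMod.val_lt i, ZMod.natCast_zmod_val i⟩
  have hs : ∀ x, x ∈ (p.append q).support ↔ ∃ i, R.Blk s i x := by
    intro x
    rw [Walk.mem_support_append_iff, p2, q2]
    constructor
    · rintro (⟨j, hj, h⟩ | h)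
      · exact ⟨_, h⟩
      · exact ⟨_, h⟩
    · rintro ⟨i, h⟩
      obtain ⟨j, hj, rfl⟩ := hcast i
      rcases Nat.lt_succ_iff_lt_or_eq.1 hj with hj | rfl
      · exact Or.inl ⟨j, hj, h⟩
      · exact Or.inr h
  have e1 : ∀ i, ∀ e, e ∈ (R.side (s i) i).edges → e ∈ (p.append q).edges := by
    intro i e he
    obtain ⟨j, hj, rfl⟩ := hcast i
    rw [Walk.edges_append, List.mem_append]
    rcases Nat.lt_succ_iff_lt_or_eq.1 hj with hj | rfl
    · exact Or.inl (p3 j hj e he)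
    · exact Or.inr (q3 e he)
  have e2 : ∀ i, ∀ e, e ∈ (R.conn i).edges → e ∈ (p.append q).edges := by
    intro i e he
    obtain ⟨j, hj, rfl⟩ := hcast i
    rw [Walk.edges_append, List.mem_append]
    rcases Nat.lt_succ_iff_lt_or_eq.1 hj with hj | rfl
    · exact Or.inl (p4 j hj e he)
    · exact Or.inr (q4 e he)
  refine ⟨_, p.append q, ⟨⟨p1.isCycle_append q1 ?_ (Or.inl (by omega)), ?_⟩, ?_⟩, hs⟩
  · intro x h1 h2
    have h1' := (p2 x).1 (List.mem_of_mem_tail h1)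
    have h2' := (q2 x).1 (List.mem_of_mem_tail h2)
    obtain ⟨j, hj, h1'⟩ := h1'
    rcases R.blk_inter s (cast_ne hj (by omega)) h1' h2' with ⟨f1, f2⟩ | ⟨f1, f2⟩
    · rw [f2] at h2; exact not_mem_tail q1 h2
    · rw [f2, f1, ← hk0] at h1; exact not_mem_tail p1 h1
  · intro x y hx hy h
    rw [hs] at hx hy
    have w : ∀ z, (∃ i, R.Blk s i z) → R.W0 z := by
      rintro z ⟨i, h | h⟩
      · exact Or.inl ⟨_, _, h⟩
      · exact Or.inr ⟨_, h⟩
    rcases R.adj x y (w x hx) (w y hy) h with ⟨t, i, hi⟩ | ⟨i, hi⟩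
    · by_cases ht : t = s i
      · subst ht; exact e1 _ _ hi
      · exfalso
        have key : ∀ z, (∃ i, R.Blk s i z) → z ∈ (R.side t i).support → z = R.a i ∨ z = R.b i := by
          rintro z ⟨j, hz⟩ hz'
          by_cases hij : j = i
          · subst hij
            rcases hz with hz | hz
            · exact R.side_inter' ht hz' hz
            · rcases R.conn_side _ _ _ z hz hz' with ⟨-, f⟩ | ⟨f1, f⟩
              · exact Or.inr f
              · left; rw [f, ← f1]
          · rcases hz with hz | hz
            · rcases R.bead_inter _ _ j i hij z hz hz' with ⟨-, -, f⟩ | ⟨-, f, -⟩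
              · exact Or.inl f
              · exact Or.inr f
            · rcases R.conn_side _ _ _ z hz hz' with ⟨f1, f⟩ | ⟨f1, f⟩
              · exact (hij f1.symm).elim
              · left; rw [f, ← f1]
        exact R.nonadj' (key x hx (Walk.fst_mem_support_of_mem_edges _ hi))
          (key y hy (Walk.snd_mem_support_of_mem_edges _ hi)) h
    · exact e2 _ _ hi
  · rw [Walk.length_append]; omega

end NRing

namespace NRing
variable {U : Type} {S : SimpleGraph U} {m : ℕ} {arc lt : U → U → Prop} {rk : U → ℕ}

def Glob (R : NRing S m) (s : ZMod m → Bool) (x : U) : Prop := ∃ i, R.Blk s i x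

theorem w0_of_bead (R : NRing S m) {i : ZMod m} {x : U} (h : R.Bead i x) : R.W0 x := by
  obtain ⟨t, h⟩ := h
  exact Or.inl ⟨t, i, h⟩

theorem a_mem (R : NRing S m) (t : Bool) (i : ZMod m) : R.a i ∈ (R.side t i).support := by simp

theorem b_mem (R : NRing S m) (t : Bool) (i : ZMod m) : R.b i ∈ (R.side t i).support := by simp

theorem w0_glob (R : NRing S m) {x : U} (h : R.W0 x) : ∃ s, R.Glob s x := by
  rcases h with ⟨t, i, h⟩ | ⟨i, h⟩
  · exact ⟨fun _ => t, i, Or.inl h⟩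
  · exact ⟨fun _ => true, i, Or.inr h⟩

theorem w0_glob' (R : NRing S m) {x : U} (h : R.W0 x) {i : ZMod m} (hi : ¬ R.Bead i x) (t : Bool) :
    ∃ s, s i = t ∧ R.Glob s x := by
  classical
  rcases h with ⟨t', j, h⟩ | ⟨j, h⟩
  · have hij : j ≠ i := by
      rintro rfl
      exact hi ⟨_, h⟩
    refine ⟨Function.update (fun _ => t') i t, by simp, j, Or.inl ?_⟩
    rw [Function.update_of_ne hij]
    exact h
  · exact ⟨fun _ => t, rfl, j, Or.inr h⟩

theorem globL (R : NRing S m) (hm : 4 ≤ m) (h : BRel S arc lt rk) {s : ZMod m → Bool} {z u : U}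
    (hz : R.Glob s z) (hu : R.Glob s u) (hl : lt u z) {w : U} (hw : R.Glob s w) :
    w = z ∨ arc w z ∨ lt w z := by
  obtain ⟨v, c, hc, hs⟩ := R.global_hole hm s
  exact holeL h c hc ((hs _).2 hz) ((hs _).2 hu) hl w ((hs _).2 hw)

theorem beadL (R : NRing S m) (hm : 4 ≤ m) (h : BRel S arc lt rk) {i : ZMod m} {z u : U}
    (hz : R.Bead i z) (hu : R.Bead i u) (hl : lt u z) {w : U} (hw : R.Bead i w) :
    w = z ∨ arc w z ∨ lt w z := by
  obtain ⟨v, c, hc, hs⟩ := R.bead_hole hm i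
  exact holeL h c hc ((hs _).2 hz) ((hs _).2 hu) hl w ((hs _).2 hw)

theorem far (R : NRing S m) (hm : 4 ≤ m) {i : ZMod m} {z : U}
    (hz : R.Bead i z ∨ z ∈ (R.conn i).support) :
    R.a (i+2) ≠ z ∧ ¬ S.Adj z (R.a (i+2)) := by
  obtain ⟨n1, n2, n3⟩ := zmod_ne hm
  have x1 : ∀ t, z ∉ (R.side t (i+2)).support := by
    intro t ht
    rcases hz with ⟨t', hz⟩ | hz
    · rcases R.bead_inter t' t i (i+2) (fun e => n2 (by linear_combination -e)) z hz ht with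
        ⟨e, -⟩ | ⟨e, -⟩
      · exact n1 (by linear_combination e)
      · exact n3 (by linear_combination -e)
    · rcases R.conn_side i t (i+2) z hz ht with ⟨e, -⟩ | ⟨e, -⟩
      · exact n2 (by linear_combination e)
      · exact n1 (by linear_combination e)
  have hzW : R.W0 z := by
    rcases hz with hz | hz
    · exact R.w0_of_bead hz
    · exact Or.inr ⟨_, hz⟩
  refine ⟨?_, ?_⟩
  · rintro rfl
    exact x1 true (R.a_mem _ _)
  · intro h
    rcases R.adj z _ hzW (Or.inl ⟨true, _, R.a_mem _ _⟩) h with ⟨t, j, hj⟩ | ⟨j, hj⟩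
    · have hz' := Walk.fst_mem_support_of_mem_edges _ hj
      have ha' := Walk.snd_mem_support_of_mem_edges _ hj
      by_cases e0 : j = i + 2
      · subst e0; exact x1 t hz'
      rcases R.bead_inter t true j (i+2) e0 _ ha' (R.a_mem _ _) with ⟨e1, e2, -⟩ | ⟨e1, e2, -⟩
      · have e3 : j = i + 1 := by linear_combination -e1
        subst e3
        have za : z = R.a (i+1) := by
          rcases hz with ⟨t', hz⟩ | hz
          · rcases R.bead_inter t' t i (i+1) (fun e => n1 (by linear_combination -e)) z hz hz' with
              ⟨-, -, e⟩ | ⟨e, -⟩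
            · exact e
            · exact (n2 (by linear_combination -e)).elim
          · rcases R.conn_side i t (i+1) z hz hz' with ⟨e, -⟩ | ⟨-, e⟩
            · exact (n1 (by linear_combination e)).elim
            · exact e
        rw [e2, za] at h
        exact R.ab_nonadj _ h
      · exact R.ab_ne _ e2
    · have hz' := Walk.fst_mem_support_of_mem_edges _ hj
      have ha' := Walk.snd_mem_support_of_mem_edges _ hj
      rcases R.conn_side j true (i+2) _ ha' (R.a_mem _ _) with ⟨e1, e2⟩ | ⟨e1, e2⟩
      · subst e1; exact R.ab_ne _ e2
      · have e3 : j = i + 1 := by linear_combination -e1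
        subst e3
        rcases hz with ⟨t', hz⟩ | hz
        · rcases R.conn_side (i+1) t' i z hz' hz with ⟨e, -⟩ | ⟨e, -⟩
          · exact n1 (by linear_combination -e)
          · exact n2 (by linear_combination -e)
        · exact R.conn_conn i (i+1) (fun e => n1 (by linear_combination -e)) z hz hz'

theorem transfer (R : NRing S m) (hm : 4 ≤ m) (h : BRel S arc lt rk) {i : ZMod m} {z u : U}
    (hz : R.Bead i z ∨ z ∈ (R.conn i).support) {s s' : ZMod m → Bool} (h1 : R.Glob s z)
    (h2 : R.Glob s' z) (hu : R.Glob s u) (hl : lt u z) {v : U} (hv : R.Glob s' v) :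
    v = z ∨ arc v z ∨ lt v z := by
  obtain ⟨f1, f2⟩ := R.far hm hz
  have ga : ∀ s, R.Glob s (R.a (i+2)) := fun s => ⟨i+2, Or.inl (R.a_mem _ _)⟩
  rcases R.globL hm h h1 hu hl (ga s) with e | e | e
  · exact (f1 e).elim
  · exact (f2 ((h.adj_iff _ _).2 (Or.inr e))).elim
  · exact R.globL hm h h2 (ga s') e hv

theorem conn_super (R : NRing S m) (hm : 4 ≤ m) (h : BRel S arc lt rk) {i : ZMod m} {z u : U}
    (hz : z ∈ (R.conn i).support) (hu : R.W0 u) (hl : lt u z) {v : U} (hv : R.W0 v) :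
    v = z ∨ arc v z ∨ lt v z := by
  obtain ⟨s, hs⟩ := R.w0_glob hu
  obtain ⟨s', hs'⟩ := R.w0_glob hv
  exact R.transfer hm h (Or.inr hz) (s := s) (s' := s') ⟨i, Or.inr hz⟩ ⟨i, Or.inr hz⟩ hs hl hs'

def Big (R : NRing S m) (arc lt : U → U → Prop) (i : ZMod m) (p : U) : Prop :=
  ∀ v, R.W0 v → ¬ R.Bead i v → arc v p ∨ lt v p

def Loc (R : NRing S m) (arc lt : U → U → Prop) (i : ZMod m) (p : U) : Prop :=
  (∀ u, R.W0 u → lt u p → R.Bead i u) ∧ arc (R.a i) p ∧ arc (R.b i) p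

theorem big_or_loc (R : NRing S m) (hm : 4 ≤ m) (h : BRel S arc lt rk) (i : ZMod m) :
    ∃ p, R.Bead i p ∧ (R.Big arc lt i p ∨ R.Loc arc lt i p) := by
  obtain ⟨v, c, hc, hs⟩ := R.bead_hole hm i
  obtain ⟨p, hp, y, hy, hl⟩ := holeTop h c hc
  rw [hs] at hp hy
  refine ⟨p, hp, ?_⟩
  by_cases hA : ∃ s u, p ∈ (R.side (s i) i).support ∧ R.Glob s u ∧ lt u p
  · obtain ⟨s, u, h1, h2, h3⟩ := hA
    left
    intro v hv hnv
    obtain ⟨s', e, hs'⟩ := R.w0_glob' hv hnv (s i)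
    rcases R.transfer hm h (Or.inl hp) (s := s) (s' := s') ⟨i, Or.inl h1⟩ ⟨i, Or.inl (by rw [e]; exact h1)⟩ h2
      h3 hs' with e' | e'
    · subst e'; exact (hnv hp).elim
    · exact e'
  · right
    have hpp := hp
    obtain ⟨t, ht⟩ := hp
    have hend : ∀ x, (∀ t, x ∈ (R.side t i).support) → arc x p := by
      intro x hx
      rcases R.beadL hm h hpp hy hl ⟨true, hx _⟩ with e | e | e
      · exfalso
        obtain ⟨t', hy⟩ := hy
        exact hA ⟨fun _ => t', y, e ▸ hx t', ⟨i, Or.inl hy⟩, hl⟩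
      · exact e
      · exact (hA ⟨fun _ => t, x, ht, ⟨i, Or.inl (hx t)⟩, e⟩).elim
    refine ⟨?_, hend _ (fun t => R.a_mem t i), hend _ (fun t => R.b_mem t i)⟩
    intro u hu hlu
    by_contra hn
    obtain ⟨s', e, hs'⟩ := R.w0_glob' hu hn t
    exact hA ⟨s', u, by rw [e]; exact ht, hs', hlu⟩

theorem big_big (R : NRing S m) (h : BRel S arc lt rk) {i k : ZMod m} {p q : U}
    (hp : R.Bead i p) (hq : R.Bead k q) (h1 : R.Big arc lt i p) (h2 : R.Big arc lt k q)
    (hik : i ≠ k) : k = i + 1 ∨ i = k + 1 := by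
  by_contra hne
  have dis : ∀ x, R.Bead i x → R.Bead k x → False := by
    rintro x ⟨t, ht⟩ ⟨t', ht'⟩
    rcases R.bead_inter t t' i k hik x ht ht' with ⟨e, -⟩ | ⟨e, -⟩
    · exact hne (Or.inl e)
    · exact hne (Or.inr e)
  exact h.nocomp (h1 q (R.w0_of_bead hq) (fun e => dis _ e hq))
    (h2 p (R.w0_of_bead hp) (fun e => dis _ hp e))

theorem loc_loc (R : NRing S m) (hm : 4 ≤ m) (h : BRel S arc lt rk) {i : ZMod m} {p q : U}
    (hp : R.Bead i p) (hq : R.Bead (i+1) q) (h1 : R.Loc arc lt i p)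
    (h2 : R.Loc arc lt (i+1) q) :
    ∃ z ∈ (R.conn i).support, (∀ k, ¬ R.Bead k z) ∧ ∀ v, R.W0 v → v = z ∨ arc v z ∨ lt v z := by
  classical
  obtain ⟨n1, n2, n3⟩ := zmod_ne hm
  have cb : ∀ x, x ∈ (R.conn i).support → R.Bead i x → x = R.b i := by
    rintro x hx ⟨t, ht⟩
    rcases R.conn_side i t i x hx ht with ⟨-, e⟩ | ⟨e, -⟩
    · exact e
    · exact (n1 (by linear_combination -e)).elim
  have ca : ∀ x, x ∈ (R.conn i).support → R.Bead (i+1) x → x = R.a (i+1) := by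
    rintro x hx ⟨t, ht⟩
    rcases R.conn_side i t (i+1) x hx ht with ⟨e, -⟩ | ⟨-, e⟩
    · exact (n1 (by linear_combination e)).elim
    · exact e
  have bb : ∀ x, R.Bead i x → R.Bead (i+1) x → x = R.b i ∧ x = R.a (i+1) := by
    rintro x ⟨t, ht⟩ ⟨t', ht'⟩
    rcases R.bead_inter t t' i (i+1) (fun e => n1 (by linear_combination -e)) x ht ht' with
      ⟨-, e⟩ | ⟨e, -⟩
    · exact e
    · exact (n2 (by linear_combination -e)).elim
  have pb : p ≠ R.b i := by
    intro e; have := h1.2.2; rw [← e] at this; exact h.arc_irrefl _ this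
  have qa : q ≠ R.a (i+1) := by
    intro e; have := h2.2.1; rw [← e] at this; exact h.arc_irrefl _ this
  have W : ∀ x, x ∈ (R.conn i).support → R.W0 x := fun x hx => Or.inr ⟨i, hx⟩
  have ex : ∃ z ∈ (R.conn i).support, ∃ u, R.W0 u ∧ lt u z := by
    obtain ⟨r, hr, hmax⟩ := ((R.conn i).support.toFinset).exists_max_image rk ⟨R.b i, by simp⟩
    simp only [List.mem_toFinset] at hr hmax
    have out : ∀ x ∈ (R.conn i).support, S.Adj r x → arc r x := by
      intro x hx ha
      rcases (h.adj_iff _ _).1 ha with h1 | h1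
      · exact h1
      · have := h.A1 _ _ h1; have := hmax x hx; omega
    obtain ⟨k, rfl, hk⟩ := Walk.mem_support_iff_exists_getVert.1 hr
    have g0 : (R.conn i).getVert 0 = R.b i := by simp
    have gL : (R.conn i).getVert (R.conn i).length = R.a (i+1) := by simp
    have gm : ∀ j, (R.conn i).getVert j ∈ (R.conn i).support := fun j =>
      Walk.getVert_mem_support _ _
    have prev : 0 < k → arc ((R.conn i).getVert k) ((R.conn i).getVert (k-1)) := by
      intro h0
      apply out _ (gm _)
      have := (R.conn i).adj_getVert_succ (i := k-1) (by omega)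
      rw [show k - 1 + 1 = k by omega] at this
      exact this.symm
    have next : k < (R.conn i).length →
        arc ((R.conn i).getVert k) ((R.conn i).getVert (k+1)) := by
      intro h0
      exact out _ (gm _) ((R.conn i).adj_getVert_succ h0)
    by_cases k0 : k = 0
    · subst k0
      by_cases kL : 0 = (R.conn i).length
      · exfalso
        rw [← kL, g0] at gL
        have hne : p ≠ q := by
          rintro rfl
          exact pb (bb p hp hq).1
        have hbq : arc (R.b i) q := by rw [gL]; exact h2.2.1
        rcases h.A2 _ _ _ h1.2.2 hbq hne with e | e
        · exact pb (bb p hp (h2.1 p (R.w0_of_bead hp) e)).1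
        · exact qa (bb q (h1.1 q (R.w0_of_bead hq) e) hq).2
      · have e1 := next (by omega)
        rw [g0] at e1
        have nw : ¬ R.Bead i ((R.conn i).getVert (0+1)) := by
          intro e
          rw [cb _ (gm _) e] at e1
          exact h.arc_irrefl _ e1
        refine ⟨_, gm (0+1), p, R.w0_of_bead hp, ?_⟩
        rcases h.A2 _ _ _ e1 h1.2.2 (fun e => nw (e ▸ hp)) with e | e
        · exact (nw (h1.1 _ (W _ (gm _)) e)).elim
        · exact e
    · by_cases kL : k = (R.conn i).length
      · have e1 := prev (by omega)
        rw [kL, gL] at e1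
        have nw : ¬ R.Bead (i+1) ((R.conn i).getVert ((R.conn i).length-1)) := by
          intro e
          rw [ca _ (gm _) e] at e1
          exact h.arc_irrefl _ e1
        refine ⟨_, gm ((R.conn i).length-1), q, R.w0_of_bead hq, ?_⟩
        rcases h.A2 _ _ _ e1 h2.2.1 (fun e => nw (e ▸ hq)) with e | e
        · exact (nw (h2.1 _ (W _ (gm _)) e)).elim
        · exact e
      · have hne : (R.conn i).getVert (k-1) ≠ (R.conn i).getVert (k+1) := by
          intro e
          have := (R.conn_path i).getVert_injOn (by simp; omega) (by simp; omega) e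
          omega
        rcases h.A2 _ _ _ (prev (by omega)) (next (by omega)) hne with e | e
        · exact ⟨_, gm (k+1), _, W _ (gm _), e⟩
        · exact ⟨_, gm (k-1), _, W _ (gm _), e⟩
  obtain ⟨z, hz, u, hu, hl⟩ := ex
  have sup : ∀ v, R.W0 v → v = z ∨ arc v z ∨ lt v z := fun v hv => R.conn_super hm h hz hu hl hv
  have key : ∀ x, R.W0 x → ¬ arc z x := by
    intro x hx ha
    rcases sup x hx with e | e
    · subst e; exact h.arc_irrefl _ ha
    · exact h.nocomp e (Or.inl ha)
  refine ⟨z, hz, ?_, sup⟩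
  rintro k ⟨t, ht⟩
  rcases R.conn_side i t k z hz ht with ⟨-, e⟩ | ⟨-, e⟩
  · exact key p (R.w0_of_bead hp) (e ▸ h1.2.2)
  · exact key q (R.w0_of_bead hq) (e ▸ h2.2.1)

theorem core (R : NRing S m) (hm : 4 ≤ m) (h : BRel S arc lt rk) : False := by
  obtain ⟨n1, n2, n3⟩ := zmod_ne hm
  choose p hp hbl using R.big_or_loc hm h
  by_cases hex : ∃ i, R.Loc arc lt i (p i) ∧ R.Loc arc lt (i+1) (p (i+1))
  · have nb : ∀ k, ¬ R.Big arc lt k (p k) := by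
      obtain ⟨i, h1, h2⟩ := hex
      obtain ⟨z, hz, hzb, hsup⟩ := R.loc_loc hm h (hp i) (hp (i+1)) h1 h2
      intro k hk
      have e1 := hk z (Or.inr ⟨i, hz⟩) (hzb k)
      rcases hsup (p k) (R.w0_of_bead (hp k)) with e | e
      · exact hzb k (e ▸ hp k)
      · exact h.nocomp e1 e
    have al : ∀ k, R.Loc arc lt k (p k) := fun k => (hbl k).resolve_left (nb k)
    obtain ⟨z, hz, hzb, hsup⟩ := R.loc_loc hm h (hp 0) (hp (0+1)) (al _) (al _)
    obtain ⟨z', hz', hzb', hsup'⟩ := R.loc_loc hm h (hp 1) (hp (1+1)) (al _) (al _)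
    have hne : z ≠ z' := by
      rintro rfl
      exact R.conn_conn 0 1 (Ne.symm n1) z hz hz'
    exact h.nocomp ((hsup z' (Or.inr ⟨_, hz'⟩)).resolve_left (Ne.symm hne))
      ((hsup' z (Or.inr ⟨_, hz⟩)).resolve_left hne)
  · have hb : ∀ i, R.Big arc lt i (p i) ∨ R.Big arc lt (i+1) (p (i+1)) := by
      intro i
      by_contra hn
      push Not at hn
      exact hex ⟨i, (hbl i).resolve_left hn.1, (hbl (i+1)).resolve_left hn.2⟩
    have sep : ∀ i, R.Big arc lt i (p i) → R.Big arc lt (i+2) (p (i+2)) → False := by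
      intro i h1 h2
      rcases R.big_big h (hp i) (hp (i+2)) h1 h2 (fun e => n2 (by linear_combination -e)) with e | e
      · exact n1 (by linear_combination e)
      · exact n3 (by linear_combination -e)
    have nb : ∀ i, R.Big arc lt i (p i) → False := by
      intro i h1
      have h3 : R.Big arc lt (i+1) (p (i+1)) := by
        rcases hb (i+1) with e | e
        · exact e
        · rw [show i + 1 + 1 = i + 2 by ring] at e
          exact (sep i h1 e).elim
      have h4 : R.Big arc lt (i+1+2) (p (i+1+2)) := by
        rcases hb (i+2) with e | e
        · exact (sep i h1 e).elim
        · rw [show i + 2 + 1 = i + 1 + 2 by ring] at e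
          exact e
      exact sep _ h3 h4
    rcases hb 0 with e | e
    · exact nb _ e
    · exact nb _ e

end NRing

theorem inForbs_of_necklace {V : Type} {G : SimpleGraph V} {m : ℕ}
    (N : Necklace G m) (hm : 4 ≤ m) (B : BSys) : InForbs G B.graph := by
  rintro U S ⟨f, P, hS⟩ ⟨g, hg⟩
  obtain ⟨R, hR⟩ := N.toNRing hm
  obtain ⟨R'⟩ := R.subdiv hm hR hS
  exact R'.core hm (B.brel.comap g hg)

/-- every `m`-necklace with `m ≥ 4` is not weakly pervasive. -/
theorem necklace_not_weaklyPervasive (V : Type) (G : SimpleGraph V) (m : ℕ)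
    (N : Necklace G m) (hm : 4 ≤ m) : ¬ WeaklyPervasive G := by
  exact final_of G (fun B => inForbs_of_necklace N hm B)

end BurlingFormal
end

section
/- Let G_1 and G_2 be graphs, let x_i ∈ V(G_i) be a global subordinate vertex of G_i for i = 1, 2, and let D be a dumbbell of G_1 and G_2 with respect to x_1 and x_2 (obtained by joining x_1 and x_2 by a path of length ≥ 0). If G_1 and G_2 are Burling graphs, then D is not a Burling graph. -/
namespace BurlingFormal

open SimpleGraph

namespace BurlingTree
variable {V : Type} (T : BurlingTree V)

open Classical in
noncomputable def depth (v : V) : ℕ := Nat.find (T.reach v)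

def Anc (v w : V) : Prop := ∃ n, T.parent^[n] w = v

def PD (v w : V) : Prop := T.Anc v w ∧ v ≠ w

open Classical in
lemma depth_parent (w : V) (h : w ≠ T.root) : T.depth (T.parent w) + 1 = T.depth w := by
  unfold depth
  have h1 := Nat.find_spec (T.reach w)
  have h2 := Nat.find_spec (T.reach (T.parent w))
  apply le_antisymm
  · have h0 : Nat.find (T.reach w) ≠ 0 := by
      intro h0; rw [h0] at h1; exact h h1
    obtain ⟨k, hk⟩ := Nat.exists_eq_succ_of_ne_zero h0
    rw [hk] at h1 ⊢
    rw [Nat.succ_eq_add_one, Function.iterate_succ_apply] at h1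
    have := Nat.find_min' (T.reach (T.parent w)) h1
    omega
  · apply Nat.find_min'
    rw [Function.iterate_succ_apply]; exact h2

lemma parent_ne (w : V) (h : w ≠ T.root) : T.parent w ≠ w := by
  intro h1
  have := T.depth_parent w h
  rw [h1] at this; omega

variable {T}

lemma Anc.refl (v : V) : T.Anc v v := ⟨0, rfl⟩

lemma Anc.trans {a b c : V} (h : T.Anc a b) (h' : T.Anc b c) : T.Anc a c := by
  obtain ⟨n, rfl⟩ := h
  obtain ⟨m, rfl⟩ := h'
  exact ⟨n + m, by rw [Function.iterate_add_apply]⟩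

lemma Anc.parent (v : V) : T.Anc (T.parent v) v := ⟨1, rfl⟩

lemma PD.anc_parent {v w : V} (h : T.PD v w) : T.Anc v (T.parent w) := by
  obtain ⟨⟨n, hn⟩, hne⟩ := h
  cases n with
  | zero => exact absurd hn.symm hne
  | succ n => exact ⟨n, by rw [← Function.iterate_succ_apply]; exact hn⟩

lemma depth_parent_le (w : V) : T.depth (T.parent w) ≤ T.depth w := by
  by_cases h : w = T.root
  · rw [h, T.parent_root]
  · have := T.depth_parent w h; omega

lemma Anc.depth_le {v w : V} (h : T.Anc v w) : T.depth v ≤ T.depth w := by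
  obtain ⟨n, rfl⟩ := h
  induction n with
  | zero => exact le_rfl
  | succ n ih => rw [Function.iterate_succ_apply']; exact (depth_parent_le _).trans ih

lemma PD.ne_root {v w : V} (h : T.PD v w) : w ≠ T.root := by
  rintro rfl
  obtain ⟨⟨n, hn⟩, hne⟩ := h
  exact hne (by rw [← hn, Function.iterate_fixed T.parent_root])

lemma PD.depth_lt {v w : V} (h : T.PD v w) : T.depth v < T.depth w := by
  have h1 := h.anc_parent.depth_le
  have := T.depth_parent w h.ne_root
  omega

lemma PD.asymm {v w : V} (h : T.PD v w) (h' : T.PD w v) : False := by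
  have := h.depth_lt
  have := h'.depth_lt
  omega

lemma Arc.basic {u w : V} (h : T.Arc u w) : u ≠ T.root ∧ u ≠ T.lastBorn (T.parent u) ∧
    T.parent (T.lastBorn (T.parent u)) = T.parent u ∧ T.lastBorn (T.parent u) ≠ T.root ∧
    T.depth (T.lastBorn (T.parent u)) = T.depth (T.parent u) + 1 ∧
    (T.lastBorn (T.parent u) ∈ T.choosePath u ∧
      (∀ w ∈ T.choosePath u, w ≠ T.lastBorn (T.parent u) →
        T.parent w ∈ T.choosePath u ∧ T.parent w ≠ w) ∧
    ∀ w ∈ T.choosePath u, ∀ w' ∈ T.choosePath u, w ≠ T.lastBorn (T.parent u) →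
      w' ≠ T.lastBorn (T.parent u) → T.parent w = T.parent w' → w = w') := by
  unfold Arc at h
  have h0 : ¬ (u = T.root ∨ u = T.lastBorn (T.parent u)) := by
    intro h0; rw [T.choosePath_empty u h0] at h; exact h
  push Not at h0
  have hb := T.choosePath_branch u h0.1 h0.2
  have hl := T.lastBorn_child (T.parent u) ⟨u, (T.parent_ne u h0.1).symm, rfl⟩
  have hr : T.lastBorn (T.parent u) ≠ T.root := by
    intro hr
    apply hl.2
    have := hl.1
    rw [hr, T.parent_root] at this
    rw [hr, this]
  have hd := T.depth_parent _ hr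
  rw [hl.1] at hd
  refine ⟨h0.1, h0.2, hl.1, hr, hd.symm, ?_⟩
  rcases hb with hb | hb
  · rw [hb] at h; exact h.elim
  · exact hb

lemma Arc.anc {u w : V} (h : T.Arc u w) : T.Anc (T.lastBorn (T.parent u)) w := by
  obtain ⟨h1, h2, h3, h4, h5, h6, h7, h8⟩ := h.basic
  induction hn : T.depth w using Nat.strong_induction_on generalizing w with
  | _ n ih =>
    by_cases hw : w = T.lastBorn (T.parent u)
    · rw [hw]; exact Anc.refl _
    · have := h7 w h hw
      have hr : w ≠ T.root := fun hr => this.2 (by rw [hr, T.parent_root])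
      have hd := T.depth_parent w hr
      exact (ih _ (by omega) this.1 rfl).trans (Anc.parent w)

lemma Arc.up {u w v : V} (h : T.Arc u w) (hv : T.Anc v w) :
    T.Arc u v ∨ T.Anc v (T.parent u) := by
  obtain ⟨h1, h2, h3, h4, h5, h6, h7, h8⟩ := h.basic
  obtain ⟨n, rfl⟩ := hv
  induction n with
  | zero => exact Or.inl h
  | succ n ih =>
    rw [Function.iterate_succ_apply']
    rcases ih with ih | ih
    · by_cases hw : T.parent^[n] w = T.lastBorn (T.parent u)
      · rw [hw, h3]; exact Or.inr (Anc.refl _)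
      · exact Or.inl (h7 _ ih hw).1
    · exact Or.inr ((Anc.parent _).trans ih)

lemma Arc.comparable {u w w' : V} (h : T.Arc u w) (h' : T.Arc u w') :
    T.Anc w w' ∨ T.Anc w' w := by
  obtain ⟨h1, h2, h3, h4, h5, h6, h7, h8⟩ := h.basic
  induction hn : T.depth w using Nat.strong_induction_on generalizing w with
  | _ n ih =>
    by_cases hw : w = T.lastBorn (T.parent u)
    · left; rw [hw]; exact h'.anc
    · have hp := h7 w h hw
      have hr : w ≠ T.root := fun hr => hp.2 (by rw [hr, T.parent_root])
      have hd := T.depth_parent w hr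
      have hpa : T.Arc u (T.parent w) := hp.1
      have hpd := hpa.anc.depth_le
      rcases ih _ (by omega) hpa rfl with h9 | h9
      · obtain ⟨k, hk⟩ := h9
        cases k with
        | zero => right; exact ⟨1, hk.symm⟩
        | succ k =>
          rw [Function.iterate_succ_apply'] at hk
          have hle := depth_parent_le (T := T) (T.parent^[k] w')
          rw [hk] at hle
          rcases h'.up (v := T.parent^[k] w') ⟨k, rfl⟩ with h10 | h10
          · by_cases hy : T.parent^[k] w' = T.lastBorn (T.parent u)
            · rw [hy, h3] at hk
              rw [← hk] at hpd
              omega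
            · left
              exact ⟨k, h8 _ h10 _ h hy hw hk⟩
          · have := h10.depth_le
            omega
      · exact Or.inr (h9.trans (Anc.parent w))

lemma Arc.into {u w v : V} (h : T.Arc u w) (hv : T.PD v w) : T.PD v u ∨ T.Arc u v := by
  rcases h.up hv.1 with h1 | h1
  · exact Or.inr h1
  · left
    refine ⟨h1.trans (Anc.parent u), ?_⟩
    rintro rfl
    have := h1.depth_le
    have := T.depth_parent v h.basic.1
    omega

lemma Arc.out {u w v : V} (h : T.Arc w u) (hv : T.PD v w) : T.PD v u := by
  obtain ⟨h1, h2, h3, h4, h5, -⟩ := h.basic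
  have ha := hv.anc_parent
  have hb : T.Anc (T.parent w) (T.lastBorn (T.parent w)) := ⟨1, h3⟩
  refine ⟨(ha.trans hb).trans h.anc, ?_⟩
  rintro rfl
  have := ha.depth_le
  have := h.anc.depth_le
  omega

lemma Arc.not_PD {u v : V} (h : T.Arc u v) : ¬ T.PD v u := by
  intro hv
  obtain ⟨h1, h2, h3, h4, h5, -⟩ := h.basic
  have := hv.anc_parent.depth_le
  have := h.anc.depth_le
  omega

lemma Arc.depth_le {u v : V} (h : T.Arc u v) : T.depth u ≤ T.depth v := by
  obtain ⟨h1, h2, h3, h4, h5, -⟩ := h.basic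
  have := h.anc.depth_le
  have := T.depth_parent u h1
  omega

lemma Arc.sink {u v w : V} (h : T.Arc u v) (hd : T.depth v ≤ T.depth u) (h' : T.Arc v w) :
    False := by
  obtain ⟨h1, h2, h3, h4, h5, -⟩ := h.basic
  have hp := T.depth_parent u h1
  have hv : T.lastBorn (T.parent u) = v := by
    by_contra hne
    have : T.PD (T.lastBorn (T.parent u)) v := ⟨h.anc, hne⟩
    have := this.depth_lt
    omega
  apply h'.basic.2.1
  rw [← hv, h3]

end BurlingTree

/-- Conclusion about a source `a` of a hole. -/
def GoodSource {W V : Type} {G : SimpleGraph W} {v : W} (A : W → W → Prop) (T : BurlingTree V)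
    (g : W → V) (c : G.Walk v v) (a : W) : Prop :=
  ∃ p b, s(a, p) ∈ c.edges ∧ s(b, p) ∈ c.edges ∧ A a p ∧ A b p ∧ IsHoleSink A c p ∧
    IsHoleSource A c b ∧ ∀ x ∈ c.support, x = a ∨ x = b ∨ x = p ∨ T.PD (g p) (g x)

lemma core {W V : Type} {G : SimpleGraph W} {A : W → W → Prop} (hO : IsOrientation G A)
    (T : BurlingTree V) (g : W → V) (hA : ∀ u v, A u v ↔ T.Arc (g u) (g v))
    {a : W} (c : G.Walk a a) (hc : IsHole G c) (ha : IsHoleSource A c a)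
    (hpd : T.PD (g c.snd) (g c.penultimate)) : GoodSource A T g c a := by
  obtain ⟨⟨hcyc, hch⟩, hlen⟩ := hc
  have nb : ∀ i, i ≠ 0 → i < c.length → ∀ y, s(c.getVert i, y) ∈ c.edges ↔
      y = c.getVert (i - 1) ∨ y = c.getVert (i + 1) := by
    intro i h0 h1 y
    have := hcyc.neighborSet_toSubgraph_internal h0 h1
    rw [← Walk.adj_toSubgraph_iff_mem_edges, ← Subgraph.mem_neighborSet, this]
    simp
  have nb1 := nb 1 (by omega) (by omega)
  have nb2 := nb 2 (by omega) (by omega)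
  have key : ∀ w w', G.Adj w w' → T.PD (g c.snd) (g w) → ¬ A w' c.snd →
      T.PD (g c.snd) (g w') := by
    intro w w' h hp hn
    by_cases h1 : A w w'
    · exact ((hA _ _).1 h1).out hp
    · have h2 : A w' w := by
        have := hO.2 w w' h
        tauto
      rcases ((hA _ _).1 h2).into hp with h3 | h3
      · exact h3
      · exact absurd ((hA _ _).2 h3) hn
  have hrange : ∀ k, k + 4 ≤ c.length → T.PD (g c.snd) (g (c.getVert (c.length - 1 - k))) := by
    intro k
    induction k with
    | zero => intro _; exact hpd
    | succ k ih =>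
      intro hk
      have h1 := ih (by omega)
      have h2 : G.Adj (c.getVert (c.length - 1 - (k + 1)))
          (c.getVert (c.length - 1 - (k + 1) + 1)) :=
        c.adj_getVert_succ (by omega)
      rw [show c.length - 1 - (k + 1) + 1 = c.length - 1 - k by omega] at h2
      refine key _ _ h2.symm h1 ?_
      intro h3
      have h4 := hch _ _ (Walk.getVert_mem_support c 1) (Walk.getVert_mem_support c _)
        (hO.1 _ _ h3).symm
      rw [nb1] at h4
      rcases h4 with h4 | h4
      · have := (hcyc.getVert_endpoint_iff (i := c.length - 1 - (k + 1)) (by omega)).1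
          (by rw [h4]; simp)
        omega
      · have := hcyc.getVert_injOn (by rw [Set.mem_ofPred_eq]; omega)
          (by rw [Set.mem_ofPred_eq]; omega) h4
        omega
  have hrange' : ∀ i, 3 ≤ i → i < c.length → T.PD (g c.snd) (g (c.getVert i)) := by
    intro i h3 h4
    have := hrange (c.length - 1 - i) (by omega)
    rwa [show c.length - 1 - (c.length - 1 - i) = i by omega] at this
  have hnn : ¬ T.PD (g c.snd) (g c.snd) := fun h => h.2 rfl
  have hadj12 : G.Adj (c.getVert 1) (c.getVert 2) := c.adj_getVert_succ (by omega)
  have hadj23 : G.Adj (c.getVert 2) (c.getVert 3) := c.adj_getVert_succ (by omega)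
  have hv3 := hrange' 3 le_rfl (by omega)
  have hb : A (c.getVert 2) c.snd := by
    by_contra hb
    have h2 := key _ _ hadj23.symm hv3 hb
    refine hnn (key _ _ hadj12.symm h2 ?_)
    intro h
    exact (hO.1 _ _ h).ne rfl
  have e10 : s(a, c.snd) ∈ c.edges := by
    rw [Sym2.eq_swap]; exact (nb1 a).2 (Or.inl (by simp))
  have hap := ha.2 _ e10
  have e12 : s(c.getVert 2, c.snd) ∈ c.edges := by
    rw [Sym2.eq_swap]; exact (nb1 _).2 (Or.inr rfl)
  refine ⟨c.snd, c.getVert 2, e10, e12, hap, hb, ⟨Walk.getVert_mem_support c 1, ?_⟩,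
    ⟨Walk.getVert_mem_support c 2, ?_⟩, ?_⟩
  · intro y hy
    rcases (nb1 y).1 hy with rfl | rfl
    · simpa using hap
    · exact hb
  · intro y hy
    rcases (nb2 y).1 hy with rfl | rfl
    · exact hb
    · by_contra h
      have h2 : A (c.getVert 3) (c.getVert 2) := by
        have := hO.2 _ _ hadj23
        tauto
      exact ((hA _ _).1 hb).not_PD (((hA _ _).1 h2).out hv3)
  · intro x hx
    obtain ⟨i, rfl, hi⟩ := Walk.mem_support_iff_exists_getVert.1 hx
    by_cases h0 : i = 0
    · subst h0; simp
    by_cases h1 : i = 1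
    · subst h1; exact Or.inr (Or.inr (Or.inl rfl))
    by_cases h2 : i = 2
    · subst h2; simp
    by_cases h3 : i = c.length
    · subst h3; simp
    exact Or.inr (Or.inr (Or.inr (hrange' i (by omega) (by omega))))

lemma goodSource {W V : Type} {G : SimpleGraph W} {A : W → W → Prop} (hO : IsOrientation G A)
    (T : BurlingTree V) (g : W → V) (hg : Function.Injective g)
    (hA : ∀ u v, A u v ↔ T.Arc (g u) (g v))
    {v : W} (c : G.Walk v v) (hc : IsHole G c) (a : W) (ha : IsHoleSource A c a) :
    GoodSource A T g c a := by
  classical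
  obtain ⟨⟨hcyc, hch⟩, hlen⟩ := hc
  -- reduction: any closed walk at `a` with same support and edges
  have red : ∀ c' : G.Walk a a, c'.IsCycle → c'.length = c.length →
      (∀ x, x ∈ c'.support ↔ x ∈ c.support) → (∀ e, e ∈ c'.edges ↔ e ∈ c.edges) →
      T.PD (g c'.snd) (g c'.penultimate) → GoodSource A T g c a := by
    intro c' h1 h2 h3 h4 h5
    have := core hO T g hA c' ⟨⟨h1, by simpa only [h3, h4] using hch⟩, by omega⟩
      (by simpa only [IsHoleSource, h3, h4] using ha) h5
    simpa only [GoodSource, IsHoleSource, IsHoleSink, h3, h4] using this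
  let r := c.rotate a ha.1
  have hr : r.IsCycle := hcyc.rotate ha.1
  have hrl : r.length = c.length := by simp [r]
  have hrs : ∀ x, x ∈ r.support ↔ x ∈ c.support := fun x => by
    simp [r, Walk.mem_support_rotate_iff]
  have hre : ∀ e, e ∈ r.edges ↔ e ∈ c.edges := fun e => (c.rotate_edges a ha.1).mem_iff
  have hnb := hr.neighborSet_toSubgraph_endpoint
  have n1 : A a r.snd := by
    apply ha.2
    rw [← hre, ← Walk.adj_toSubgraph_iff_mem_edges, ← Subgraph.mem_neighborSet, hnb]; simp
  have n2 : A a r.penultimate := by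
    apply ha.2
    rw [← hre, ← Walk.adj_toSubgraph_iff_mem_edges, ← Subgraph.mem_neighborSet, hnb]; simp
  have hne : g r.snd ≠ g r.penultimate := fun h => hr.snd_ne_penultimate (hg h)
  rcases ((hA _ _).1 n1).comparable ((hA _ _).1 n2) with h | h
  · exact red r hr hrl hrs hre ⟨h, hne⟩
  · refine red r.reverse hr.reverse (by simpa using hrl) (by simpa using hrs)
      (by simpa using hre) ?_
    simpa [BurlingTree.PD] using And.intro h hne.symm

lemma exists_source {W V : Type} {G : SimpleGraph W} {A : W → W → Prop} (hO : IsOrientation G A)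
    (T : BurlingTree V) (g : W → V)
    (hA : ∀ u v, A u v ↔ T.Arc (g u) (g v))
    {v : W} (c : G.Walk v v) : ∃ a, IsHoleSource A c a := by
  by_contra hno
  push Not at hno
  have inn : ∀ x ∈ c.support, ∃ y ∈ c.support, A y x := by
    intro x hx
    have := hno x
    unfold IsHoleSource at this
    push Not at this
    obtain ⟨y, hy, hxy⟩ := this hx
    refine ⟨y, c.snd_mem_support_of_mem_edges hy, ?_⟩
    have := hO.2 x y (c.adj_of_mem_edges hy)
    tauto
  obtain ⟨u, hu, hmin⟩ := exists_minimalFor_of_wellFoundedLT (fun x => x ∈ c.support)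
    (fun x => T.depth (g x)) ⟨v, c.start_mem_support⟩
  have hmin' : ∀ y ∈ c.support, T.depth (g u) ≤ T.depth (g y) := by
    intro y hy
    rcases le_total (T.depth (g u)) (T.depth (g y)) with h | h
    · exact h
    · exact hmin hy h
  obtain ⟨y, hy, hyu⟩ := inn u hu
  obtain ⟨z, hz, hzy⟩ := inn y hy
  have l1 := ((hA _ _).1 hyu).depth_le
  have l2 := hmin' z hz
  exact ((hA _ _).1 hzy).sink (l1.trans l2) ((hA _ _).1 hyu)

lemma hole_sub {W V : Type} {G : SimpleGraph W} {A : W → W → Prop} (hO : IsOrientation G A)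
    (T : BurlingTree V) (g : W → V) (hg : Function.Injective g)
    (hA : ∀ u v, A u v ↔ T.Arc (g u) (g v))
    {v : W} (c : G.Walk v v) (hc : IsHole G c) (x : W) (hx : IsHoleSubordinate A c x) :
    ∃ p ∈ c.support, T.PD (g p) (g x) := by
  obtain ⟨a, ha⟩ := exists_source hO T g hA c
  have asym : ∀ u v, A u v → A v u → False := fun u v h h' => (hO.2 u v (hO.1 u v h)).1 h h'
  obtain ⟨p, b, h1, h2, h3, h4, h5, h6, h7⟩ := goodSource hO T g hg hA c hc a ha
  have main : ∀ p' b', A b' p' → s(b', p') ∈ c.edges → IsHoleSink A c p' →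
      ∀ p a b, s(a, p) ∈ c.edges → s(b, p) ∈ c.edges → A a p → A b p →
      (∀ x ∈ c.support, x = a ∨ x = b ∨ x = p ∨ T.PD (g p) (g x)) →
      p' = p ∨ T.PD (g p) (g p') := by
    intro p' b' k1 k2 k3 p a b h1 h2 h3 h4 h7
    rcases h7 p' k3.1 with h | h | h | h
    · subst h; exact (asym _ _ h3 (k3.2 _ h1)).elim
    · subst h; exact (asym _ _ h4 (k3.2 _ h2)).elim
    · exact Or.inl h
    · exact Or.inr h
  have piv : IsHolePivot A c p := by
    refine ⟨h5, fun y hy => ?_⟩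
    obtain ⟨p', b', k1, k2, k3, k4, k5, k6, k7⟩ := goodSource hO T g hg hA c hc y hy
    have : p' = p := by
      rcases main p' b' k4 k2 k5 p a b h1 h2 h3 h4 h7 with h | h
      · exact h
      rcases main p b h4 h2 h5 p' y b' k1 k2 k3 k4 k7 with h' | h'
      · exact h'.symm
      exact (h.asymm h').elim
    rw [← this, Sym2.eq_swap]; exact k1
  refine ⟨p, h5.1, ?_⟩
  rcases h7 x hx.1 with h | h | h | h
  · subst h; exact absurd ha hx.2.1
  · subst h; exact absurd h6 hx.2.1
  · subst h; exact absurd piv hx.2.2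
  · exact h

lemma half (V₁ V₂ U V : Type) (G₁ : SimpleGraph V₁) (G₂ : SimpleGraph V₂)
    (D : SimpleGraph U) (x₁ : V₁) (x₂ : V₂) (f₁ : V₁ ↪ U) (f₂ : V₂ ↪ U)
    (hf₂ : ∀ a b, G₂.Adj a b ↔ D.Adj (f₂ a) (f₂ b))
    (Q : D.Walk (f₁ x₁) (f₂ x₂))
    (hint : ∀ a b, f₁ a = f₂ b → a = x₁ ∧ b = x₂)
    (hQ₁ : ∀ w ∈ Q.support, ∀ a, f₁ a = w → a = x₁)
    (hcovE : ∀ u v, D.Adj u v → (∃ a b, G₁.Adj a b ∧ u = f₁ a ∧ v = f₁ b) ∨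
      (∃ a b, G₂.Adj a b ∧ u = f₂ a ∧ v = f₂ b) ∨ s(u, v) ∈ Q.edges)
    (A : U → U → Prop) (hO : IsOrientation D A) (T : BurlingTree V) (f : U ↪ V)
    (hA : ∀ u v, A u v ↔ T.Arc (f u) (f v))
    (p₁ : V₁) (hp : T.PD (f (f₁ p₁)) (f (f₁ x₁))) (p₂ : V₂) (R : G₂.Walk x₂ p₂) :
    T.PD (f (f₁ p₁)) (f (f₂ p₂)) := by
  have hne : p₁ ≠ x₁ := by rintro rfl; exact hp.2 rfl
  have nin : ∀ w, w ∈ Q.support ∨ (∃ b, f₂ b = w) → ¬ A w (f₁ p₁) := by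
    intro w hw hwp
    rcases hcovE _ _ (hO.1 _ _ hwp) with ⟨a, b, -, h2, h3⟩ | ⟨a, b, -, h2, h3⟩ | h
    · have : a = x₁ := by
        rcases hw with hw | ⟨b', hb'⟩
        · exact hQ₁ w hw a h2.symm
        · exact (hint a b' (h2.symm.trans hb'.symm)).1
      subst this; subst h2
      exact ((hA _ _).1 hwp).not_PD hp
    · exact hne (hint _ _ h3).1
    · exact hne (hQ₁ _ (Q.snd_mem_support_of_mem_edges h) _ rfl)
  have walk : ∀ (u w : U) (P : D.Walk u w),
      (∀ y ∈ P.support, y ∈ Q.support ∨ (∃ b, f₂ b = y)) →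
      T.PD (f (f₁ p₁)) (f u) → T.PD (f (f₁ p₁)) (f w) := by
    intro u w P
    induction P with
    | nil => intro _ h; exact h
    | @cons u v w h P ih =>
      intro hy hu
      refine ih (fun y hy' => hy y (by simp [hy'])) ?_
      by_cases h1 : A u v
      · exact ((hA _ _).1 h1).out hu
      · have h2 : A v u := by
          have := hO.2 u v h
          tauto
        rcases ((hA _ _).1 h2).into hu with h3 | h3
        · exact h3
        · exact absurd ((hA _ _).2 h3) (nin v (hy v (by simp)))
  have s1 := walk _ _ Q (fun y hy => Or.inl hy) hp
  let φ : G₂ →g D := ⟨f₂, fun {a b} h => (hf₂ a b).1 h⟩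
  refine walk _ _ (R.map φ) ?_ s1
  intro y hy
  rw [Walk.support_map, List.mem_map] at hy
  obtain ⟨b, -, hb⟩ := hy
  exact Or.inr ⟨b, hb⟩

lemma piv_walk {V₁ U V : Type} (G₁ : SimpleGraph V₁) 
    (D : SimpleGraph U) (x₁ : V₁) (f₁ : V₁ ↪ U)
    (hf₁ : ∀ a b, G₁.Adj a b ↔ D.Adj (f₁ a) (f₁ b))
    (A : U → U → Prop) (hO : IsOrientation D A) (T : BurlingTree V) (f : U ↪ V)
    (hA : ∀ u v, A u v ↔ T.Arc (f u) (f v)) (hx₁ : IsGlobalSubordinate G₁ x₁) :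
    ∃ p, T.PD (f (f₁ p)) (f (f₁ x₁)) ∧ Nonempty (G₁.Walk x₁ p) := by
  classical
  let A' : V₁ → V₁ → Prop := fun a b => A (f₁ a) (f₁ b)
  have hO' : IsOrientation G₁ A' :=
    ⟨fun u v h => (hf₁ u v).2 (hO.1 _ _ h), fun u v h => hO.2 _ _ ((hf₁ u v).1 h)⟩
  have hA' : ∀ u v, A' u v ↔ T.Arc ((f₁.trans f) u) ((f₁.trans f) v) := fun u v => hA _ _
  obtain ⟨v, c, hc, hs⟩ := hx₁ A' ⟨hO', V, T, f₁.trans f, hA'⟩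
  obtain ⟨p, hp, h⟩ := hole_sub hO' T _ (f₁.trans f).injective hA' c hc x₁ hs
  exact ⟨p, h, ⟨(c.takeUntil x₁ hs.1).reverse.append (c.takeUntil p hp)⟩⟩

/-- a dumbbell of two Burling graphs with respect to global subordinate
vertices is not a Burling graph. -/
theorem dumbbell_not_Burling (V₁ V₂ U : Type) (G₁ : SimpleGraph V₁) (G₂ : SimpleGraph V₂)
    (D : SimpleGraph U) (x₁ : V₁) (x₂ : V₂) (f₁ : V₁ ↪ U) (f₂ : V₂ ↪ U)
    (hf₁ : ∀ a b, G₁.Adj a b ↔ D.Adj (f₁ a) (f₁ b))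
    (hf₂ : ∀ a b, G₂.Adj a b ↔ D.Adj (f₂ a) (f₂ b))
    (Q : D.Walk (f₁ x₁) (f₂ x₂)) (hQ : Q.IsPath)
    (hint : ∀ a b, f₁ a = f₂ b → a = x₁ ∧ b = x₂)
    (hQ₁ : ∀ w ∈ Q.support, ∀ a, f₁ a = w → a = x₁)
    (hQ₂ : ∀ w ∈ Q.support, ∀ b, f₂ b = w → b = x₂)
    (hcovV : ∀ w : U, (∃ a, f₁ a = w) ∨ (∃ b, f₂ b = w) ∨ w ∈ Q.support)
    (hcovE : ∀ u v, D.Adj u v → (∃ a b, G₁.Adj a b ∧ u = f₁ a ∧ v = f₁ b) ∨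
      (∃ a b, G₂.Adj a b ∧ u = f₂ a ∧ v = f₂ b) ∨ s(u, v) ∈ Q.edges)
    (hB₁ : IsBurlingGraph G₁) (hB₂ : IsBurlingGraph G₂)
    (hx₁ : IsGlobalSubordinate G₁ x₁) (hx₂ : IsGlobalSubordinate G₂ x₂) :
    ¬ IsBurlingGraph D := by
  rintro ⟨A, hO, V, T, f, hA⟩
  obtain ⟨p₁, hp₁, ⟨R₁⟩⟩ := piv_walk G₁ D x₁ f₁ hf₁ A hO T f hA hx₁
  obtain ⟨p₂, hp₂, ⟨R₂⟩⟩ := piv_walk G₂ D x₂ f₂ hf₂ A hO T f hA hx₂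
  have h1 := half V₁ V₂ U V G₁ G₂ D x₁ x₂ f₁ f₂ hf₂ Q hint hQ₁ hcovE A hO T f hA p₁ hp₁ p₂ R₂
  have h2 := half V₂ V₁ U V G₂ G₁ D x₂ x₁ f₂ f₁ hf₁ Q.reverse
    (fun a b h => (hint b a h.symm).symm) (by simpa using hQ₂)
    (fun u v h => by
      rcases hcovE u v h with h | h | h
      · exact Or.inr (Or.inl h)
      · exact Or.inl h
      · exact Or.inr (Or.inr (by simpa using h))) A hO T f hA p₂ hp₂ p₁ R₁
  exact h1.asymm h2

end BurlingFormal
end
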